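/- arXiv:2212.04228 — 8 statements merged into one kernel-verified Lean document; each statement's English description precedes it below -/
import Mathlib

section
/- Let G be a group and let V, M, N be finite-dimensional complex vector spaces equipped with representations ρ_V : G → GL(V), ρ_M : G → GL(M), ρ_N : G → GL(N). Let ψ : V → Hom(M,N) be a linear map which is G-equivariant, i.e. ψ(ρ_V(g)v) = ρ_N(g) ∘ ψ(v) ∘ ρ_M(g)⁻¹ for all g ∈ G and v ∈ V. Assume G acts transitively on the projectivization of V, i.e. for all nonzero v, w ∈ V there exist g ∈ G and a nonzero scalar c ∈ ℂ with ρ_V(g)v = c·w. Then the rank of ψ(v) is the same for all nonzero v ∈ V; in other words, ψ(V) is a linear space of matrices of constant rank. -/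
open Module LinearMap

/-- If `ψ : V → Hom(M,N)` is a `G`-equivariant linear map and `G` acts transitively on the
projectivization of `V`, then `ψ(v)` has the same rank for every nonzero `v`, i.e. `ψ(V)` is a
linear space of matrices of constant rank. -/
theorem constant_rank_of_equivariant_of_transitive
    {G V M N : Type*} [Group G]
    [AddCommGroup V] [Module ℂ V] [FiniteDimensional ℂ V]
    [AddCommGroup M] [Module ℂ M] [FiniteDimensional ℂ M]
    [AddCommGroup N] [Module ℂ N] [FiniteDimensional ℂ N]
    (ρV : Representation ℂ G V) (ρM : Representation ℂ G M) (ρN : Representation ℂ G N)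
    (ψ : V →ₗ[ℂ] M →ₗ[ℂ] N)
    (hequiv : ∀ (g : G) (v : V), ψ (ρV g v) = ρN g ∘ₗ ψ v ∘ₗ ρM g⁻¹)
    (htrans : ∀ v w : V, v ≠ 0 → w ≠ 0 → ∃ (g : G) (c : ℂ), c ≠ 0 ∧ ρV g v = c • w) :
    ∀ v w : V, v ≠ 0 → w ≠ 0 →
      finrank ℂ (LinearMap.range (ψ v)) = finrank ℂ (LinearMap.range (ψ w)) := by
  intro v w hv hw
  obtain ⟨g, c, hc, hg⟩ := htrans v w hv hw
  have h_comp : ρN g ∘ₗ ψ v ∘ₗ ρM g⁻¹ = c • ψ w := by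
    rw [← hequiv, hg, map_smul]
  have h_range : (LinearMap.range (ψ v)).map (ρN g) = LinearMap.range (ψ w) := by
    rw [← LinearMap.range_smul (ψ w) c hc, ← h_comp, LinearMap.range_comp,
      LinearMap.range_comp_of_range_eq_top _
        (LinearMap.range_eq_top.2 (ρM.apply_bijective g⁻¹).surjective)]
  rw [← h_range]
  exact (Submodule.equivMapOfInjective (ρN g) (ρN.apply_bijective g).injective _).finrank_eq
end

section
/- Let V be a complex vector space of dimension n+1, let k be an integer with 1 ≤ k and 2k ≤ n, and let L = {φ_v : v ∈ V} ⊆ Hom(⋀^k V, ⋀^{k+1} V), where φ_v(x) = v ∧ x. Then the maximal rank of elements of L is C(n,k), and L is rank-critical: every linear subspace of Hom(⋀^k V, ⋀^{k+1} V) strictly containing L contains an element of rank strictly greater than C(n,k). -/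
open Module LinearMap ExteriorAlgebra

variable {V : Type*} [AddCommGroup V] [Module ℂ V]

/-- Wedging with `v` as a linear map `⋀^k V → ⋀^(k+1) V`. -/
noncomputable def wedgeMap (k : ℕ) (v : V) : ⋀[ℂ]^k V →ₗ[ℂ] ⋀[ℂ]^(k + 1) V :=
  LinearMap.codRestrict (⋀[ℂ]^(k + 1) V)
    ((LinearMap.mulLeft ℂ (ι ℂ v)) ∘ₗ (⋀[ℂ]^k V).subtype)
    (fun x => by
      have h1 : ι ℂ v ∈ LinearMap.range (ι ℂ : V →ₗ[ℂ] ExteriorAlgebra ℂ V) :=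
        LinearMap.mem_range_self _ v
      have h2 := Submodule.mul_mem_mul h1 x.2
      rwa [← pow_succ'] at h2)

section ExteriorBasis

variable {K M I : Type*} [Field K] [AddCommGroup M] [Module K M] [LinearOrder I]
  (b : Basis I K M)

theorem ι_eq_exteriorAlgebra_basis_singleton (a : I) :
    ι K (b a) = b.ExteriorAlgebra {a} := by
  rw [ExteriorAlgebra.basis_apply_ofCard b (Finset.card_singleton a)]
  simp only [ExteriorAlgebra.ιMulti_family, ExteriorAlgebra.ιMulti_succ_apply,
    ExteriorAlgebra.ιMulti_zero_apply, mul_one, Function.comp_apply]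
  congr 2
  have h := (Set.powersetCard.mem_range_ofFinEmbEquiv_symm_iff_mem
    (Set.powersetCard.ofCard (Finset.card_singleton a))
      (Set.powersetCard.ofFinEmbEquiv.symm
        (Set.powersetCard.ofCard (Finset.card_singleton a)) 0)).1 ⟨0, rfl⟩
  exact (Finset.mem_singleton.1 h).symm

theorem ι_mul_exteriorAlgebra_basis_of_mem {a : I} {s : Finset I} (h : a ∈ s) :
    ι K (b a) * b.ExteriorAlgebra s = 0 := by
  rw [ι_eq_exteriorAlgebra_basis_singleton]
  exact ExteriorAlgebra.basis_mul_of_not_disjoint b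
    (Set.powersetCard.ofCard (Finset.card_singleton a)) (Set.powersetCard.ofCard rfl)
    (by simpa [Set.powersetCard.ofCard] using h)

theorem exists_ι_mul_exteriorAlgebra_basis_of_notMem {a : I} {s : Finset I} (h : a ∉ s) :
    ∃ ε : K, ε ≠ 0 ∧
      ι K (b a) * b.ExteriorAlgebra s = ε • b.ExteriorAlgebra (insert a s) := by
  have hd : Disjoint (Set.powersetCard.ofCard (Finset.card_singleton a)).val
      (Set.powersetCard.ofCard (rfl : s.card = s.card)).val := by
    simpa [Set.powersetCard.ofCard] using h
  have key := ExteriorAlgebra.basis_mul_of_disjoint b _ _ hd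
  have hs : ((Set.powersetCard.disjUnion hd : Set.powersetCard I (1 + s.card)) : Finset I)
      = insert a s := by
    ext x
    simp [Set.powersetCard.disjUnion, Set.powersetCard.ofCard]
  rw [hs] at key
  rw [ι_eq_exteriorAlgebra_basis_singleton]
  rcases Int.units_eq_one_or (Set.powersetCard.permOfDisjoint hd).sign with h1 | h1
  · refine ⟨1, one_ne_zero, ?_⟩
    rw [h1] at key
    simpa using key
  · refine ⟨-1, neg_ne_zero.2 one_ne_zero, ?_⟩
    rw [h1] at key
    simpa using key

theorem exists_repr_ι_mul {a : I} {s : Finset I} (h : a ∉ s) :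
    ∃ ε : K, ε ≠ 0 ∧ ∀ x : ExteriorAlgebra K M,
      b.ExteriorAlgebra.repr (ι K (b a) * x) (insert a s) =
        ε * b.ExteriorAlgebra.repr x s := by
  obtain ⟨ε, hε, he⟩ := exists_ι_mul_exteriorAlgebra_basis_of_notMem b h
  refine ⟨ε, hε, fun x => ?_⟩
  suffices b.ExteriorAlgebra.coord (insert a s) ∘ₗ LinearMap.mulLeft K (ι K (b a)) =
      ε • b.ExteriorAlgebra.coord s from LinearMap.congr_fun this x
  refine b.ExteriorAlgebra.ext fun t => ?_
  by_cases hst : t = s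
  · subst hst
    simp [he]
  · by_cases hat : a ∈ t
    · simp [ι_mul_exteriorAlgebra_basis_of_mem b hat, hst]
    · obtain ⟨δ, -, hd⟩ := exists_ι_mul_exteriorAlgebra_basis_of_notMem b hat
      have hne : insert a t ≠ insert a s := fun hh => hst <| by
        rw [← Finset.erase_insert hat, hh, Finset.erase_insert h]
      simp [hd, hst, hne]

theorem repr_eq_zero_of_ι_mul_eq_zero {u : M} {s : Finset I}
    (hu : ι K u * b.ExteriorAlgebra s = 0) {m : I} (hm : m ∉ s) : b.repr u m = 0 := by
  obtain ⟨ε, hε, he⟩ := exists_ι_mul_exteriorAlgebra_basis_of_notMem b hm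
  have key : b.ExteriorAlgebra.coord (insert m s) ∘ₗ
      LinearMap.mulRight K (b.ExteriorAlgebra s) ∘ₗ ι K = ε • b.coord m := by
    refine b.ext fun a => ?_
    by_cases ham : a = m
    · subst ham
      simp [he]
    · by_cases has : a ∈ s
      · simp [ι_mul_exteriorAlgebra_basis_of_mem b has, ham]
      · obtain ⟨δ, -, hd⟩ := exists_ι_mul_exteriorAlgebra_basis_of_notMem b has
        have hne : insert a s ≠ insert m s := fun hh => by
          have h1 : a ∈ insert m s := hh ▸ Finset.mem_insert_self a s
          exact (Finset.mem_insert.1 h1).elim ham has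
        simp [hd, ham, hne]
  have h1 := LinearMap.congr_fun key u
  simp [hu] at h1
  exact h1.resolve_left hε

theorem ι_mul_eq_zero_of_repr_eq_zero [Fintype I] {u : M} {s : Finset I}
    (h : ∀ m ∉ s, b.repr u m = 0) : ι K u * b.ExteriorAlgebra s = 0 := by
  rw [← b.sum_repr u, map_sum, Finset.sum_mul]
  refine Finset.sum_eq_zero fun m _ => ?_
  by_cases hm : m ∈ s
  · simp [ι_mul_exteriorAlgebra_basis_of_mem b hm]
  · simp [h m hm]

theorem exteriorPower_eq_span_basis (k : ℕ) :
    ⋀[K]^k M = Submodule.span K (b.ExteriorAlgebra '' {s | s.card = k}) := by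
  have h := congrArg (Submodule.map (⋀[K]^k M).subtype) (b.exteriorPower k).span_eq
  rw [Submodule.map_span, Submodule.map_top, Submodule.range_subtype] at h
  rw [← h]
  congr 1
  ext x
  constructor
  · rintro ⟨_, ⟨s, rfl⟩, rfl⟩
    exact ⟨s.1, s.2, ExteriorAlgebra.basis_eq_coe_basis b s⟩
  · rintro ⟨s, hs, rfl⟩
    exact ⟨_, ⟨⟨s, hs⟩, rfl⟩, (ExteriorAlgebra.basis_eq_coe_basis b ⟨s, hs⟩).symm⟩

theorem exteriorAlgebra_basis_mem_exteriorPower {k : ℕ} {s : Finset I} (hs : s.card = k) :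
    b.ExteriorAlgebra s ∈ ⋀[K]^k M := by
  rw [exteriorPower_eq_span_basis b]
  exact Submodule.subset_span ⟨s, hs, rfl⟩

/-- An element of `⋀^(k+1) M` annihilated by all `b a`, `a ∈ s`, where `s` has `k` elements,
is divisible by the wedge product of these vectors. -/
theorem exists_eq_ι_mul_basis {k : ℕ} {s : Finset I} (hs : s.card = k)
    {x : ExteriorAlgebra K M} (hx : x ∈ ⋀[K]^(k + 1) M) (h : ∀ a ∈ s, ι K (b a) * x = 0) :
    ∃ w : M, x = ι K w * b.ExteriorAlgebra s := by
  rw [exteriorPower_eq_span_basis b, Basis.mem_span_image] at hx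
  have hmem : x ∈ Submodule.span K (b.ExteriorAlgebra '' {t | s ⊆ t ∧ t.card = k + 1}) := by
    rw [Basis.mem_span_image]
    intro t ht
    refine ⟨fun a ha => ?_, hx ht⟩
    by_contra hat
    obtain ⟨ε, hε, he⟩ := exists_repr_ι_mul b hat
    have h1 := he x
    rw [h a ha] at h1
    simp [hε] at h1
    exact (Finsupp.mem_support_iff.1 ht) h1
  have hle : Submodule.span K (b.ExteriorAlgebra '' {t | s ⊆ t ∧ t.card = k + 1}) ≤
      LinearMap.range (LinearMap.mulRight K (b.ExteriorAlgebra s) ∘ₗ ι K) := by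
    rw [Submodule.span_le]
    rintro _ ⟨t, ⟨hst, ht⟩, rfl⟩
    obtain ⟨m, hm, rfl⟩ := Finset.exists_eq_insert_iff.2 ⟨hst, by rw [hs, ht]⟩
    obtain ⟨ε, hε, he⟩ := exists_ι_mul_exteriorAlgebra_basis_of_notMem b hm
    refine ⟨ε⁻¹ • b m, ?_⟩
    simp [he, hε]
  obtain ⟨w, hw⟩ := hle hmem
  exact ⟨w, hw.symm⟩

/-- A linear map `⋀^(k+1) M → ⋀^(k+2) M` with `v ∧ B (v ∧ y) = 0` for all `v` and `y` is
the left multiplication by some vector. -/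
theorem exists_eq_ι_mul_of_ι_mul_map_ι_mul_eq_zero [Fintype I] (b : Basis I K M) {k : ℕ}
    (B : ExteriorAlgebra K M →ₗ[K] ExteriorAlgebra K M)
    (hB : ∀ x ∈ ⋀[K]^(k + 1) M, B x ∈ ⋀[K]^(k + 2) M)
    (h : ∀ v : M, ∀ y ∈ ⋀[K]^k M, ι K v * B (ι K v * y) = 0) :
    ∃ v : M, ∀ x ∈ ⋀[K]^(k + 1) M, B x = ι K v * x := by
  have hpol : ∀ v w : M, ∀ y ∈ ⋀[K]^k M,
      ι K v * B (ι K w * y) + ι K w * B (ι K v * y) = 0 := by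
    intro v w y hy
    have h1 := h (v + w) y hy
    simp only [map_add, add_mul, mul_add, h v y hy, h w y hy] at h1
    rw [← h1]
    abel
  have hex : ∀ s : Finset I, ∃ w : M, s.card = k + 1 →
      B (b.ExteriorAlgebra s) = ι K w * b.ExteriorAlgebra s := by
    intro s
    by_cases hs : s.card = k + 1
    · obtain ⟨w, hw⟩ := exists_eq_ι_mul_basis b hs
        (hB _ (exteriorAlgebra_basis_mem_exteriorPower b hs)) fun a ha => by
          obtain ⟨ε, hε, he⟩ := exists_ι_mul_exteriorAlgebra_basis_of_notMem b
            (Finset.notMem_erase a s)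
          rw [Finset.insert_erase ha] at he
          have h1 := h (b a) _ (exteriorAlgebra_basis_mem_exteriorPower b
            (show (s.erase a).card = k by rw [Finset.card_erase_of_mem ha, hs]; rfl))
          rw [he, map_smul, mul_smul_comm] at h1
          exact (smul_eq_zero.1 h1).resolve_left hε
      exact ⟨w, fun _ => hw⟩
    · exact ⟨0, fun h' => absurd h' hs⟩
  choose w hw using hex
  have hstep : ∀ (t : Finset I) (a c m : I), t.card = k → a ∉ t → c ∉ t → a ≠ c →
      m ∉ t → m ≠ a → m ≠ c → b.repr (w (insert a t)) m = b.repr (w (insert c t)) m := by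
    intro t a c m ht ha hc hac hm hma hmc
    have key : ∀ a ∉ t, B (ι K (b a) * b.ExteriorAlgebra t) =
        ι K (w (insert a t)) * (ι K (b a) * b.ExteriorAlgebra t) := by
      intro a ha
      obtain ⟨ε, -, he⟩ := exists_ι_mul_exteriorAlgebra_basis_of_notMem b ha
      rw [he, map_smul, hw _ (by rw [Finset.card_insert_of_notMem ha, ht]), mul_smul_comm]
    have h1 := hpol (b c) (b a) _ (exteriorAlgebra_basis_mem_exteriorPower b ht)
    rw [key a ha, key c hc] at h1
    have hswap : ∀ x y : M, ι K x * ι K y = - (ι K y * ι K x) := fun x y =>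
      eq_neg_of_add_eq_zero_left (ι_add_mul_swap x y)
    have h2 : ι K (w (insert a t) - w (insert c t)) *
        (ι K (b c) * (ι K (b a) * b.ExteriorAlgebra t)) = 0 := by
      have hs : ∀ (x y : M) (z : ExteriorAlgebra K M),
          ι K x * (ι K y * z) = -(ι K y * (ι K x * z)) := fun x y z => by
        rw [← mul_assoc, hswap, neg_mul, mul_assoc]
      rw [hs (b c), hs (b a) (w _), hs (b a) (b c), mul_neg, neg_neg] at h1
      rw [map_sub, sub_mul, ← neg_eq_zero, neg_sub, sub_eq_neg_add]
      exact h1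
    obtain ⟨ε, hε, he⟩ := exists_ι_mul_exteriorAlgebra_basis_of_notMem b ha
    obtain ⟨δ, hδ, hd⟩ := exists_ι_mul_exteriorAlgebra_basis_of_notMem b
      (show c ∉ insert a t by simp [hc, hac.symm])
    rw [he, mul_smul_comm, hd, smul_smul, mul_smul_comm] at h2
    have h3 := repr_eq_zero_of_ι_mul_eq_zero b
      ((smul_eq_zero.1 h2).resolve_left (mul_ne_zero hε hδ)) (m := m) (by simp [hm, hma, hmc])
    rw [map_sub, Finsupp.sub_apply] at h3
    exact sub_eq_zero.1 h3
  have hconst : ∀ (m : I) (N : ℕ) (s t : Finset I), (s \ t).card = N → s.card = k + 1 →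
      t.card = k + 1 → m ∉ s → m ∉ t → b.repr (w s) m = b.repr (w t) m := by
    intro m N
    induction N with
    | zero =>
      intro s t hN hs ht _ _
      rw [Finset.eq_of_subset_of_card_le
        (Finset.sdiff_eq_empty_iff_subset.1 (Finset.card_eq_zero.1 hN)) (by omega)]
    | succ N ih =>
      intro s t hN hs ht hms hmt
      obtain ⟨a, ha⟩ := Finset.card_pos.1 (show 0 < (s \ t).card by omega)
      obtain ⟨c, hc⟩ := Finset.card_pos.1 (show 0 < (t \ s).card by
        rw [Finset.card_sdiff_comm (ht.trans hs.symm)]; omega)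
      rw [Finset.mem_sdiff] at ha hc
      have hcard : (s.erase a).card = k := by rw [Finset.card_erase_of_mem ha.1, hs]; rfl
      have hce : c ∉ s.erase a := fun hh => hc.2 (Finset.mem_of_mem_erase hh)
      have hac : a ≠ c := fun hh => hc.2 (hh ▸ ha.1)
      have h1 := hstep (s.erase a) a c m hcard (Finset.notMem_erase a s) hce hac
        (fun hh => hms (Finset.mem_of_mem_erase hh)) (fun hh => hms (hh ▸ ha.1))
        (fun hh => hmt (hh ▸ hc.1))
      rw [Finset.insert_erase ha.1] at h1
      rw [h1]
      refine ih _ _ ?_ (by rw [Finset.card_insert_of_notMem hce, hcard]) ht ?_ hmt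
      · rw [Finset.insert_sdiff_of_mem _ hc.1, Finset.erase_sdiff_comm,
          Finset.card_erase_of_mem (Finset.mem_sdiff.2 ha), hN]
        rfl
      · simp only [Finset.mem_insert, Finset.mem_erase, not_or, not_and]
        exact ⟨fun hh => hmt (hh ▸ hc.1), fun _ => hms⟩
  have hcoef : ∀ m : I, ∃ γ : K, ∀ s : Finset I, s.card = k + 1 → m ∉ s →
      b.repr (w s) m = γ := by
    intro m
    by_cases hs : ∃ s : Finset I, s.card = k + 1 ∧ m ∉ s
    · obtain ⟨s, hs, hms⟩ := hs
      exact ⟨b.repr (w s) m, fun t ht hmt => hconst m _ t s rfl ht hs hmt hms⟩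
    · exact ⟨0, fun s h1 h2 => absurd ⟨s, h1, h2⟩ hs⟩
  choose γ hγ using hcoef
  refine ⟨∑ m, γ m • b m, ?_⟩
  have hle : ⋀[K]^(k + 1) M ≤
      LinearMap.eqLocus B (LinearMap.mulLeft K (ι K (∑ m, γ m • b m))) := by
    rw [exteriorPower_eq_span_basis b, Submodule.span_le]
    rintro _ ⟨s, hs, rfl⟩
    rw [SetLike.mem_coe, LinearMap.mem_eqLocus, LinearMap.mulLeft_apply, hw s hs,
      ← sub_eq_zero, ← sub_mul, ← map_sub]
    refine ι_mul_eq_zero_of_repr_eq_zero b fun m hm => ?_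
    rw [map_sub, Finsupp.sub_apply, Basis.repr_sum_self, hγ m s hs hm, sub_self]
  exact fun x hx => hle hx

/-- Left multiplication by a basis vector maps `⋀^k M` onto the span of those basis elements of
`⋀^(k+1) M` that involve it. -/
theorem map_mulLeft_exteriorPower (a : I) (k : ℕ) :
    (⋀[K]^k M).map (LinearMap.mulLeft K (ι K (b a))) =
      Submodule.span K (b.ExteriorAlgebra '' {t | a ∈ t ∧ t.card = k + 1}) := by
  rw [exteriorPower_eq_span_basis b, Submodule.map_span]
  apply le_antisymm <;> rw [Submodule.span_le]
  · rintro _ ⟨_, ⟨s, hs, rfl⟩, rfl⟩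
    by_cases has : a ∈ s
    · simp [ι_mul_exteriorAlgebra_basis_of_mem b has]
    · obtain ⟨ε, -, he⟩ := exists_ι_mul_exteriorAlgebra_basis_of_notMem b has
      rw [LinearMap.mulLeft_apply, he]
      refine Submodule.smul_mem _ _ (Submodule.subset_span
        ⟨_, ⟨Finset.mem_insert_self _ _, ?_⟩, rfl⟩)
      rw [Finset.card_insert_of_notMem has, hs]
  · rintro _ ⟨t, ⟨hat, ht⟩, rfl⟩
    obtain ⟨ε, hε, he⟩ := exists_ι_mul_exteriorAlgebra_basis_of_notMem b
      (Finset.notMem_erase a t)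
    rw [Finset.insert_erase hat] at he
    have h1 : b.ExteriorAlgebra t = ε⁻¹ • (ι K (b a) * b.ExteriorAlgebra (t.erase a)) := by
      simp [he, hε]
    rw [h1]
    refine Submodule.smul_mem _ _ (Submodule.subset_span ⟨_, ⟨t.erase a, ?_, rfl⟩, rfl⟩)
    rw [Set.mem_ofPred_eq, Finset.card_erase_of_mem hat, ht]
    rfl

theorem finrank_map_mulLeft_exteriorPower [Fintype I] (a : I) (k : ℕ) :
    finrank K ((⋀[K]^k M).map (LinearMap.mulLeft K (ι K (b a)))) =
      (Fintype.card I - 1).choose k := by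
  classical
  rw [map_mulLeft_exteriorPower]
  have hset : {t : Finset I | a ∈ t ∧ t.card = k + 1} =
      (((Finset.univ.erase a).powersetCard k).image (insert a) : Finset (Finset I)) := by
    ext t
    simp only [Set.mem_ofPred_eq, Finset.coe_image, Set.mem_image, Finset.mem_coe,
      Finset.mem_powersetCard]
    constructor
    · rintro ⟨hat, ht⟩
      refine ⟨t.erase a, ⟨Finset.erase_subset_erase _ (Finset.subset_univ _), ?_⟩,
        Finset.insert_erase hat⟩
      rw [Finset.card_erase_of_mem hat, ht]
      rfl
    · rintro ⟨s, ⟨hs, hc⟩, rfl⟩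
      have has : a ∉ s := fun hh => Finset.notMem_erase a _ (hs hh)
      exact ⟨Finset.mem_insert_self _ _, by rw [Finset.card_insert_of_notMem has, hc]⟩
  rw [hset, ← Finset.coe_image, finrank_span_finset_eq_card, Finset.card_image_of_injective _
    b.ExteriorAlgebra.injective, Finset.card_image_of_injOn, Finset.card_powersetCard,
    Finset.card_erase_of_mem (Finset.mem_univ a), Finset.card_univ]
  · intro s hs t ht hst
    have hmem : ∀ s ∈ (Finset.univ.erase a).powersetCard k, a ∉ s := fun s hs hh =>
      Finset.notMem_erase a _ ((Finset.mem_powersetCard.1 hs).1 hh)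
    rw [← Finset.erase_insert (hmem s hs), ← Finset.erase_insert (hmem t ht)]
    exact congrArg (fun u => Finset.erase u a) hst
  · rw [Finset.coe_image]
    exact (b.ExteriorAlgebra.linearIndependent.linearIndepOn_id).mono (Set.image_subset_range _ _)

end ExteriorBasis

/-- If the rank of `A + t B` never exceeds the rank of `A`, then `B` maps the kernel of `A` into
its range. -/
theorem map_ker_le_range_of_finrank_range_le {U W : Type*} [AddCommGroup U] [Module ℂ U]
    [AddCommGroup W] [Module ℂ W] [FiniteDimensional ℂ W] (A B : U →ₗ[ℂ] W)
    (h : ∀ t : ℂ, finrank ℂ (LinearMap.range (A + t • B)) ≤ finrank ℂ (LinearMap.range A)) :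
    (LinearMap.ker A).map B ≤ LinearMap.range A := by
  rintro _ ⟨x, hx, rfl⟩
  by_contra hBx
  set r := finrank ℂ (LinearMap.range A)
  let c := finBasis ℂ (LinearMap.range A)
  have hc : ∀ i, ∃ u, A u = (c i : W) := fun i => (c i).2
  choose u hu using hc
  have hli : LinearIndependent ℂ (Fin.cons (B x) (fun i => (c i : W)) : Fin (r + 1) → W) := by
    rw [linearIndependent_finCons]
    refine ⟨c.linearIndependent.map' _ (Submodule.ker_subtype _), fun hmem => hBx ?_⟩
    refine (Submodule.span_le.2 ?_) hmem
    rintro _ ⟨i, rfl⟩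
    exact (c i).2
  obtain ⟨π, hπ⟩ := LinearMap.exists_leftInverse_of_injective
    (Fintype.linearCombination ℂ (Fin.cons (B x) (fun i => (c i : W)) : Fin (r + 1) → W))
    (LinearMap.ker_eq_bot.2 (linearIndependent_iff_injective_fintypeLinearCombination.1 hli))
  let f : ℂ → Fin (r + 1) → W := fun t => Fin.cons (B x) (fun i => (c i : W) + t • B (u i))
  let D : ℂ → ℂ := fun t => (Matrix.of fun i j => π (f t i) j).det
  have hD0 : D 0 = 1 := by
    have h1 : (Matrix.of fun i j => π (f 0 i) j) = 1 := by
      ext i j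
      have h2 := congrFun (LinearMap.congr_fun hπ (Pi.single i 1)) j
      simp only [LinearMap.comp_apply, Fintype.linearCombination_apply_single, one_smul,
        LinearMap.id_apply] at h2
      simp only [f, zero_smul, add_zero, Matrix.of_apply, h2, Matrix.one_apply, Pi.single_apply,
        eq_comm]
    simp only [D, h1, Matrix.det_one]
  have hDc : Continuous D := by
    refine Continuous.matrix_det (continuous_matrix fun i j => ?_)
    refine Fin.cases ?_ (fun i => ?_) i
    · simpa [f] using continuous_const
    · simp only [f, Matrix.of_apply, Fin.cons_succ, map_add, map_smul, Pi.add_apply,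
        Pi.smul_apply, smul_eq_mul]
      fun_prop
  have hev : ∀ᶠ t in nhdsWithin (0 : ℂ) {0}ᶜ, D t ≠ 0 :=
    (hDc.continuousAt.eventually_ne (by rw [hD0]; exact one_ne_zero)).filter_mono
      nhdsWithin_le_nhds
  obtain ⟨t, hDt, ht⟩ := (hev.and self_mem_nhdsWithin).exists
  have ht0 : t ≠ 0 := ht
  have hlit : LinearIndependent ℂ (f t) := by
    refine LinearIndependent.of_comp π ?_
    exact Matrix.linearIndependent_rows_of_det_ne_zero hDt
  have hle : Submodule.span ℂ (Set.range (f t)) ≤ LinearMap.range (A + t • B) := by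
    rw [Submodule.span_le]
    rintro _ ⟨i, rfl⟩
    refine Fin.cases ?_ (fun i => ?_) i
    · exact ⟨t⁻¹ • x, by simp [f, LinearMap.mem_ker.1 hx, ht0]⟩
    · exact ⟨u i, by simp [f, hu]⟩
  have h1 := Submodule.finrank_mono hle
  rw [finrank_span_eq_card hlit, Fintype.card_fin] at h1
  have h2 := h t
  omega

theorem coe_wedgeMap (k : ℕ) (v : V) (x : ⋀[ℂ]^k V) :
    (wedgeMap k v x : ExteriorAlgebra ℂ V) = ι ℂ v * x := rfl

theorem span_range_wedgeMap (k : ℕ) :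
    (Submodule.span ℂ (Set.range (wedgeMap (V := V) k)) : Set _) =
      Set.range (wedgeMap (V := V) k) := by
  let F : V →ₗ[ℂ] (⋀[ℂ]^k V →ₗ[ℂ] ⋀[ℂ]^(k + 1) V) :=
    { toFun := wedgeMap k
      map_add' := fun v w => by
        refine LinearMap.ext fun x => Subtype.ext ?_
        simp [coe_wedgeMap, add_mul]
      map_smul' := fun c v => by
        refine LinearMap.ext fun x => Subtype.ext ?_
        simp [coe_wedgeMap] }
  have h : Set.range (wedgeMap (V := V) k) = (LinearMap.range F : Set _) := rfl
  rw [h, Submodule.span_eq]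

theorem finrank_range_wedgeMap [FiniteDimensional ℂ V] {n : ℕ} (hV : finrank ℂ V = n + 1)
    (k : ℕ) {v : V} (hv : v ≠ 0) :
    finrank ℂ (LinearMap.range (wedgeMap k v)) = n.choose k := by
  have hli : LinearIndepOn ℂ id {v} := LinearIndepOn.singleton hv
  let b₀ := Basis.extend hli
  let e := b₀.indexEquiv (finBasisOfFinrankEq ℂ V hV)
  have hmem : v ∈ hli.extend (Set.subset_univ _) := hli.subset_extend _ rfl
  have hb : b₀.reindex e (e ⟨v, hmem⟩) = v := by simp [b₀]
  have h := finrank_map_mulLeft_exteriorPower (b₀.reindex e) (e ⟨v, hmem⟩) k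
  rw [hb, Fintype.card_fin, Nat.add_sub_cancel] at h
  rw [← h, ← Submodule.finrank_map_subtype_eq, ← LinearMap.range_comp]
  have hcomp : (⋀[ℂ]^(k + 1) V).subtype ∘ₗ wedgeMap k v =
      LinearMap.mulLeft ℂ (ι ℂ v) ∘ₗ (⋀[ℂ]^k V).subtype := rfl
  rw [hcomp, LinearMap.range_comp, Submodule.range_subtype]

/-- For `dim V = n+1`, `1 ≤ k` and `2k ≤ n`, the space `L = {φ_v : v ∈ V}` of Koszul maps
`⋀^k V → ⋀^(k+1) V` has maximal rank `n.choose k`, and it is rank-critical: any linear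
subspace of `Hom(⋀^k V, ⋀^(k+1) V)` strictly containing `L` contains an element of rank
strictly greater than `n.choose k`. -/
theorem wedgeMap_space_rank_critical
    [FiniteDimensional ℂ V] {n : ℕ} (hV : finrank ℂ V = n + 1)
    (k : ℕ) (hk1 : 1 ≤ k) (hk2 : 2 * k ≤ n) :
    (∀ f ∈ Submodule.span ℂ (Set.range (wedgeMap (V := V) k)),
        finrank ℂ (LinearMap.range f) ≤ n.choose k) ∧
      (∃ f ∈ Submodule.span ℂ (Set.range (wedgeMap (V := V) k)),
        finrank ℂ (LinearMap.range f) = n.choose k) ∧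
      ∀ L' : Submodule ℂ (⋀[ℂ]^k V →ₗ[ℂ] ⋀[ℂ]^(k + 1) V),
        Submodule.span ℂ (Set.range (wedgeMap (V := V) k)) < L' →
          ∃ B ∈ L', n.choose k < finrank ℂ (LinearMap.range B) := by
  have : Nontrivial V := nontrivial_of_finrank_pos (R := ℂ) (by omega)
  obtain ⟨v₀, hv₀⟩ := exists_ne (0 : V)
  refine ⟨fun f hf => ?_, ⟨wedgeMap k v₀, Submodule.subset_span ⟨v₀, rfl⟩,
    finrank_range_wedgeMap hV k hv₀⟩, fun L' hL' => ?_⟩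
  · rw [← SetLike.mem_coe, span_range_wedgeMap] at hf
    obtain ⟨v, rfl⟩ := hf
    by_cases hv : v = 0
    · have h0 : wedgeMap k v = 0 := by
        refine LinearMap.ext fun x => Subtype.ext ?_
        simp [coe_wedgeMap, hv]
      rw [h0, LinearMap.range_zero, finrank_bot]
      exact Nat.zero_le _
    · exact (finrank_range_wedgeMap hV k hv).le
  · by_contra! hrank
    obtain ⟨hle, B, hBL', hB⟩ := SetLike.lt_iff_le_and_exists.1 hL'
    apply hB
    obtain ⟨j, rfl⟩ : ∃ j, k = j + 1 := ⟨k - 1, by omega⟩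
    obtain ⟨C, hC⟩ := LinearMap.exists_extend ((⋀[ℂ]^(j + 1 + 1) V).subtype ∘ₗ B)
    have hCB : ∀ x (hx : x ∈ ⋀[ℂ]^(j + 1) V), C x = B ⟨x, hx⟩ := fun x hx =>
      LinearMap.congr_fun hC ⟨x, hx⟩
    have hzero : ∀ v : V, ∀ y ∈ ⋀[ℂ]^j V, ι ℂ v * C (ι ℂ v * y) = 0 := by
      intro v y hy
      by_cases hv : v = 0
      · simp [hv]
      · have hker := map_ker_le_range_of_finrank_range_le (wedgeMap (j + 1) v) B fun t => by
          rw [finrank_range_wedgeMap hV _ hv]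
          exact hrank _ (L'.add_mem (hle (Submodule.subset_span ⟨v, rfl⟩))
            (L'.smul_mem t hBL'))
        have hmem : wedgeMap j v ⟨y, hy⟩ ∈ LinearMap.ker (wedgeMap (j + 1) v) := by
          rw [LinearMap.mem_ker]
          apply Subtype.ext
          simp [coe_wedgeMap, ← mul_assoc]
        obtain ⟨z, hz⟩ := hker ⟨_, hmem, rfl⟩
        have h1 : C (ι ℂ v * y) = ι ℂ v * z := by
          rw [← coe_wedgeMap, hz]
          exact hCB _ (wedgeMap j v ⟨y, hy⟩).2
        rw [h1, ← mul_assoc, ι_sq_zero, zero_mul]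
    obtain ⟨v, hv⟩ := exists_eq_ι_mul_of_ι_mul_map_ι_mul_eq_zero
      (finBasisOfFinrankEq ℂ V hV) C (fun x hx => by rw [hCB x hx]; exact (B ⟨x, hx⟩).2) hzero
    refine Submodule.subset_span ⟨v, ?_⟩
    refine LinearMap.ext fun x => Subtype.ext ?_
    rw [coe_wedgeMap, ← hv x x.2, hCB x x.2]
end

section
/- Let V be a complex vector space of dimension n+1 with n ≥ 1. For v ∈ V, let Φ_v : V ⊗ V → (⋀²V) ⊗ V be the linear map determined by Φ_v(x ⊗ y) = (x ∧ v) ⊗ y + (y ∧ v) ⊗ x. Then for every nonzero v ∈ V: (1) the kernel of Φ_v equals the sum of the subspace of antisymmetric tensors (the span of all x ⊗ y − y ⊗ x) and the line spanned by v ⊗ v; equivalently, the restriction of Φ_v to the subspace of symmetric tensors has kernel exactly ℂ·(v ⊗ v); (2) consequently rank Φ_v = (n² + 3n)/2, independent of the nonzero v. -/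
open Module LinearMap ExteriorAlgebra TensorProduct

/-- The second exterior power `⋀²V`, as a submodule of the exterior algebra. -/
noncomputable def extSq (V : Type*) [AddCommGroup V] [Module ℂ V] :
    Submodule ℂ (ExteriorAlgebra ℂ V) := ⋀[ℂ]^2 V

variable {V : Type*} [AddCommGroup V] [Module ℂ V]

/-- The wedge product `V × V → ⋀²V` as a bilinear map. -/
noncomputable def wedge2 : V →ₗ[ℂ] V →ₗ[ℂ] extSq V :=
  LinearMap.mk₂ ℂ
    (fun x y => ⟨ι ℂ x * ι ℂ y, by
      have h := Submodule.mul_mem_mul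
        (LinearMap.mem_range_self (ι ℂ : V →ₗ[ℂ] ExteriorAlgebra ℂ V) x)
        (LinearMap.mem_range_self (ι ℂ : V →ₗ[ℂ] ExteriorAlgebra ℂ V) y)
      rwa [← pow_two] at h⟩)
    (fun x x' y => Subtype.ext <| by simp [add_mul])
    (fun c x y => Subtype.ext <| by simp [smul_mul_assoc])
    (fun x y y' => Subtype.ext <| by simp [mul_add])
    (fun c x y => Subtype.ext <| by simp [mul_smul_comm])

/-- The linear map `Φ_v : V ⊗ V → (⋀²V) ⊗ V` determined by
`Φ_v(x ⊗ y) = (x ∧ v) ⊗ y + (y ∧ v) ⊗ x`. -/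
noncomputable def Phi (v : V) : V ⊗[ℂ] V →ₗ[ℂ] (extSq V) ⊗[ℂ] V :=
  TensorProduct.lift <| LinearMap.mk₂ ℂ
    (fun x y => wedge2 x v ⊗ₜ[ℂ] y + wedge2 y v ⊗ₜ[ℂ] x)
    (fun x x' y => by
      simp only [map_add, LinearMap.add_apply, add_tmul, tmul_add]; abel)
    (fun c x y => by
      simp only [map_smul, LinearMap.smul_apply, smul_tmul', tmul_smul, smul_add])
    (fun x y y' => by
      simp only [map_add, LinearMap.add_apply, add_tmul, tmul_add]; abel)
    (fun c x y => by
      simp only [map_smul, LinearMap.smul_apply, smul_tmul', tmul_smul, smul_add])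
/-- The map `⋀²V → V ⊗ V`, `x ∧ y ↦ x ⊗ y - y ⊗ x`. -/
noncomputable def wedgeToTensor : extSq V →ₗ[ℂ] V ⊗[ℂ] V :=
  exteriorPower.alternatingMapLinearEquiv (R := ℂ) (n := 2) (M := V) (N := V ⊗[ℂ] V)
    { toFun := fun a => a 0 ⊗ₜ[ℂ] a 1 - a 1 ⊗ₜ[ℂ] a 0
      map_update_add' := fun a i x y => by
        fin_cases i <;> simp [add_tmul, tmul_add] <;> abel
      map_update_smul' := fun a i c x => by
        fin_cases i <;> simp [smul_tmul', tmul_smul, smul_sub]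
      map_eq_zero_of_eq' := fun a i j h hij => by
        fin_cases i <;> fin_cases j <;> simp_all }

lemma wedge2_eq_ιMulti (x y : V) : wedge2 x y = exteriorPower.ιMulti ℂ 2 ![x, y] :=
  Subtype.ext <| by simp [wedge2, ExteriorAlgebra.ιMulti_apply]

@[simp] lemma wedgeToTensor_wedge2 (x y : V) :
    wedgeToTensor (wedge2 x y) = x ⊗ₜ[ℂ] y - y ⊗ₜ[ℂ] x := by
  rw [wedge2_eq_ιMulti, wedgeToTensor]
  erw [exteriorPower.alternatingMapLinearEquiv_apply_ιMulti]
  rfl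

lemma span_wedge2 : Submodule.span ℂ {u : extSq V | ∃ x y : V, u = wedge2 x y} = ⊤ := by
  rw [eq_top_iff]
  refine (exteriorPower.ιMulti_span ℂ 2 V).ge.trans (Submodule.span_mono ?_)
  rintro _ ⟨a, rfl⟩
  refine ⟨a 0, a 1, ?_⟩
  rw [wedge2_eq_ιMulti]
  congr 1
  ext i
  fin_cases i <;> rfl

@[simp] lemma wedge2_self (x : V) : wedge2 x x = 0 :=
  Subtype.ext <| by simp [wedge2]

lemma wedge2_swap (x y : V) : wedge2 x y = -wedge2 y x := by
  have h := wedge2_self (x + y)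
  simp only [map_add, LinearMap.add_apply, wedge2_self, zero_add, add_zero] at h
  exact eq_neg_of_add_eq_zero_right h

lemma lift_wedge2_wedgeToTensor (u : extSq V) :
    TensorProduct.lift wedge2 (wedgeToTensor u) = (2 : ℂ) • u := by
  have h : TensorProduct.lift wedge2 ∘ₗ wedgeToTensor = (2 : ℂ) • LinearMap.id (M := extSq V) := by
    refine LinearMap.ext_on span_wedge2 ?_
    rintro _ ⟨x, y, rfl⟩
    simp [wedge2_swap y x, two_smul]
  exact LinearMap.congr_fun h u

lemma wedgeToTensor_injective : Function.Injective (wedgeToTensor (V := V)) := by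
  refine (injective_iff_map_eq_zero _).2 fun u hu => ?_
  have h := lift_wedge2_wedgeToTensor u
  rw [hu, map_zero] at h
  exact (smul_eq_zero.1 h.symm).resolve_left two_ne_zero

lemma range_wedgeToTensor : LinearMap.range (wedgeToTensor (V := V)) =
    Submodule.span ℂ {t : V ⊗[ℂ] V | ∃ x y : V, t = x ⊗ₜ[ℂ] y - y ⊗ₜ[ℂ] x} := by
  rw [LinearMap.range_eq_map, ← span_wedge2, Submodule.map_span]
  congr 1
  ext t
  constructor
  · rintro ⟨_, ⟨x, y, rfl⟩, rfl⟩
    exact ⟨x, y, wedgeToTensor_wedge2 x y⟩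
  · rintro ⟨x, y, rfl⟩
    exact ⟨_, ⟨x, y, rfl⟩, wedgeToTensor_wedge2 x y⟩

lemma wedgeToTensor_lift_wedge2 (t : V ⊗[ℂ] V) :
    wedgeToTensor (TensorProduct.lift wedge2 t) = t - TensorProduct.comm ℂ V V t := by
  induction t with
  | zero => simp
  | tmul x y => simp
  | add s t hs ht => simp only [map_add, hs, ht]; abel

lemma Phi_tmul (v x y : V) :
    Phi v (x ⊗ₜ[ℂ] y) = wedge2 x v ⊗ₜ[ℂ] y + wedge2 y v ⊗ₜ[ℂ] x := rfl

/-- Contraction of the first tensor factor with a functional. -/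
noncomputable def contractFst (f : Dual ℂ V) : V ⊗[ℂ] V →ₗ[ℂ] V :=
  TensorProduct.lid ℂ V ∘ₗ LinearMap.rTensor V f

@[simp] lemma contractFst_tmul (f : Dual ℂ V) (x y : V) :
    contractFst f (x ⊗ₜ[ℂ] y) = f x • y := by simp [contractFst]

/-- The interior product with `f`, `x ∧ y ↦ f y • x - f x • y`. -/
noncomputable def interior2 (f : Dual ℂ V) : extSq V →ₗ[ℂ] V :=
  contractFst f ∘ₗ (-wedgeToTensor)

@[simp] lemma interior2_wedge2 (f : Dual ℂ V) (x y : V) :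
    interior2 f (wedge2 x y) = f y • x - f x • y := by simp [interior2]

lemma rTensor_interior2_Phi {f : Dual ℂ V} {v : V} (hf : f v = 1) (t : V ⊗[ℂ] V) :
    LinearMap.rTensor V (interior2 f) (Phi v t) =
      (t + TensorProduct.comm ℂ V V t) -
        v ⊗ₜ[ℂ] contractFst f (t + TensorProduct.comm ℂ V V t) := by
  induction t with
  | zero => simp
  | tmul x y =>
    simp only [Phi_tmul, map_add, LinearMap.rTensor_tmul, interior2_wedge2, hf, one_smul,
      TensorProduct.comm_tmul, contractFst_tmul, sub_tmul, tmul_add, smul_tmul]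
    abel
  | add s t hs ht =>
    simp only [map_add, hs, ht, tmul_add]
    abel

/-- A symmetric tensor of the form `v ⊗ w` with `f v = 1` is a multiple of `v ⊗ v`. -/
lemma eq_smul_tmul_self_of_comm {f : Dual ℂ V} {v w : V} (hf : f v = 1)
    (h : w ⊗ₜ[ℂ] v = v ⊗ₜ[ℂ] w) : v ⊗ₜ[ℂ] w = f w • v ⊗ₜ[ℂ] v := by
  have hw := congrArg (contractFst f) h
  simp only [contractFst_tmul, hf, one_smul] at hw
  rw [← tmul_smul, hw]

lemma ker_Phi {v : V} (hv : v ≠ 0) :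
    LinearMap.ker (Phi v) =
      LinearMap.range (wedgeToTensor (V := V)) ⊔ Submodule.span ℂ {v ⊗ₜ[ℂ] v} := by
  apply le_antisymm
  · intro t ht
    obtain ⟨f, hf⟩ := Projective.exists_dual_eq_one ℂ hv
    have h := rTensor_interior2_Phi hf t
    rw [LinearMap.mem_ker.1 ht, map_zero] at h
    set s := t + TensorProduct.comm ℂ V V t with hs
    have hsv : s = v ⊗ₜ[ℂ] contractFst f s := sub_eq_zero.1 h.symm
    have hsymm : TensorProduct.comm ℂ V V s = s := by
      have hinv : TensorProduct.comm ℂ V V (TensorProduct.comm ℂ V V t) = t :=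
        (TensorProduct.comm ℂ V V).symm_apply_apply t
      rw [hs, map_add, hinv, add_comm]
    have hcomm : contractFst f s ⊗ₜ[ℂ] v = v ⊗ₜ[ℂ] contractFst f s := by
      rw [← TensorProduct.comm_tmul, ← hsv, hsymm]
    have hs' : s = f (contractFst f s) • v ⊗ₜ[ℂ] v :=
      hsv.trans (eq_smul_tmul_self_of_comm hf hcomm)
    have htwo : (2 : ℂ) • t = wedgeToTensor (TensorProduct.lift wedge2 t) + s := by
      rw [wedgeToTensor_lift_wedge2, hs, two_smul]
      abel
    refine (Submodule.smul_mem_iff _ (two_ne_zero (α := ℂ))).1 ?_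
    rw [htwo]
    refine Submodule.add_mem_sup (LinearMap.mem_range_self _ _) ?_
    rw [hs']
    exact Submodule.smul_mem _ _ (Submodule.mem_span_singleton_self _)
  · rw [range_wedgeToTensor]
    refine sup_le (Submodule.span_le.2 ?_) (Submodule.span_le.2 ?_)
    · rintro _ ⟨x, y, rfl⟩
      simp [Phi_tmul, add_comm]
    · rintro _ rfl
      simp [Phi_tmul]

lemma disjoint_range_wedgeToTensor_span_tmul_self (v : V) :
    Disjoint (LinearMap.range (wedgeToTensor (V := V))) (Submodule.span ℂ {v ⊗ₜ[ℂ] v}) := by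
  rw [Submodule.disjoint_def]
  rintro _ ⟨u, rfl⟩ hu
  obtain ⟨a, ha⟩ := Submodule.mem_span_singleton.1 hu
  have h := lift_wedge2_wedgeToTensor u
  rw [← ha, map_smul, TensorProduct.lift.tmul, wedge2_self, smul_zero] at h
  rw [(smul_eq_zero.1 h.symm).resolve_left two_ne_zero, map_zero]

lemma finrank_range_wedgeToTensor [FiniteDimensional ℂ V] :
    finrank ℂ (LinearMap.range (wedgeToTensor (V := V))) = (finrank ℂ V).choose 2 :=
  (LinearMap.finrank_range_of_inj wedgeToTensor_injective).trans (exteriorPower.finrank_eq ℂ 2)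

lemma finrank_ker_Phi [FiniteDimensional ℂ V] {v : V} (hv : v ≠ 0) :
    finrank ℂ (LinearMap.ker (Phi v)) = (finrank ℂ V).choose 2 + 1 := by
  have hvv : v ⊗ₜ[ℂ] v ≠ 0 := by
    obtain ⟨f, hf⟩ := Projective.exists_dual_eq_one ℂ hv
    intro h
    have h' := congrArg (contractFst f) h
    rw [contractFst_tmul, hf, one_smul, map_zero] at h'
    exact hv h'
  have h := Submodule.finrank_sup_add_finrank_inf_eq
    (LinearMap.range (wedgeToTensor (V := V))) (Submodule.span ℂ {v ⊗ₜ[ℂ] v})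
  rw [(disjoint_range_wedgeToTensor_span_tmul_self v).eq_bot, finrank_bot, add_zero,
    finrank_range_wedgeToTensor, finrank_span_singleton hvv] at h
  rw [ker_Phi hv, h]

/-- For `dim V = n + 1` with `n ≥ 1` and every nonzero `v ∈ V`, the kernel of
`Φ_v : V ⊗ V → (⋀²V) ⊗ V`, `x ⊗ y ↦ (x ∧ v) ⊗ y + (y ∧ v) ⊗ x`, is the sum of the space of
antisymmetric tensors and the line spanned by `v ⊗ v`; consequently its rank is
`(n² + 3n)/2`, independent of the nonzero vector `v`. -/
theorem ker_Phi_and_rank_Phi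
    [FiniteDimensional ℂ V] {n : ℕ} (hV : finrank ℂ V = n + 1) (hn : 1 ≤ n)
    (v : V) (hv : v ≠ 0) :
    LinearMap.ker (Phi v) =
        Submodule.span ℂ {t : V ⊗[ℂ] V | ∃ x y : V, t = x ⊗ₜ[ℂ] y - y ⊗ₜ[ℂ] x} ⊔
          Submodule.span ℂ {v ⊗ₜ[ℂ] v} ∧
      finrank ℂ (LinearMap.range (Phi v)) = (n ^ 2 + 3 * n) / 2 := by
  refine ⟨by rw [ker_Phi hv, range_wedgeToTensor], ?_⟩
  have h := LinearMap.finrank_range_add_finrank_ker (K := ℂ) (V := V ⊗[ℂ] V)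
    (V₂ := extSq V ⊗[ℂ] V) (Phi v)
  rw [finrank_ker_Phi hv, finrank_tensorProduct, hV] at h
  rw [Nat.choose_two_right] at h
  have he : 2 * ((n + 1) * (n + 1 - 1) / 2) = (n + 1) * n :=
    Nat.mul_div_cancel' (by simpa [mul_comm] using (Nat.even_mul_succ_self n).two_dvd)
  have hr : n ^ 2 + 3 * n = 2 * finrank ℂ (LinearMap.range (Phi v)) := by nlinarith
  omega
end

section
/- For (x,y,z) ∈ ℂ³, let M(x,y,z) be the 6×8 complex matrix with rows: (−y, −z, 0, 0, 0, 0, 0, 0), (0, 0, x, 0, −z, 0, 0, 0), (0, 0, 0, x, 0, y, 0, 0), (x, 0, −y, 0, 0, 0, −z, z), (0, x, 0, −z, 0, 0, 0, −y), (0, 0, 0, 0, y, −z, x, 0). Then for every (x,y,z) ≠ (0,0,0), the matrix M(x,y,z) has rank exactly 5. -/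
/-- Over a field, a matrix whose left kernel is the line spanned by a nonzero vector has rank one
less than its number of rows. -/
theorem Matrix.rank_add_one_eq_card_of_vecMul_eq_zero_iff {K m n : Type*} [Field K] [Fintype m]
    [Fintype n] (A : Matrix m n K) (v : m → K) (hv : v ≠ 0)
    (hA : ∀ w : m → K, A.vecMul w = 0 ↔ ∃ c : K, c • v = w) :
    A.rank + 1 = Fintype.card m := by
  have hker : LinearMap.ker A.transpose.mulVecLin = Submodule.span K {v} := by
    ext w
    rw [LinearMap.mem_ker, Matrix.mulVecLin_apply, Matrix.mulVec_transpose,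
      Submodule.mem_span_singleton, hA]
  have hrank := LinearMap.finrank_range_add_finrank_ker A.transpose.mulVecLin
  rw [hker, finrank_span_singleton hv, Module.finrank_fintype_fun_eq_card] at hrank
  rw [← Matrix.rank_transpose]
  exact hrank

/-- The explicit `6 × 8` matrix of linear forms in three variables realizing the inclusion
`ℂ³ ⊂ Hom(S₂ℂ³, S₍₂,₁₎ℂ³)`: it has rank exactly `5` for every `(x,y,z) ≠ (0,0,0)`. -/
theorem rank_eq_five_of_ne_zero (x y z : ℂ) (h : (x, y, z) ≠ (0, 0, 0)) :
    (!![-y, -z, 0, 0, 0, 0, 0, 0;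
        0, 0, x, 0, -z, 0, 0, 0;
        0, 0, 0, x, 0, y, 0, 0;
        x, 0, -y, 0, 0, 0, -z, z;
        0, x, 0, -z, 0, 0, 0, -y;
        0, 0, 0, 0, y, -z, x, 0] : Matrix (Fin 6) (Fin 8) ℂ).rank = 5 := by
  have hxyz : x ≠ 0 ∨ y ≠ 0 ∨ z ≠ 0 := by
    by_contra! h0
    exact h (by simp [h0])
  refine Nat.succ_injective (Matrix.rank_add_one_eq_card_of_vecMul_eq_zero_iff _
    ![x ^ 2, y ^ 2, z ^ 2, x * y, x * z, y * z] (fun hv => ?_) fun w => ⟨fun hw => ?_, ?_⟩)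
  · have hx := congrFun hv 0
    have hy := congrFun hv 1
    have hz := congrFun hv 2
    simp at hx hy hz
    simp_all
  · have h0 := congrFun hw 0
    have h1 := congrFun hw 1
    have h2 := congrFun hw 2
    have h3 := congrFun hw 3
    have h4 := congrFun hw 4
    have h5 := congrFun hw 5
    have h6 := congrFun hw 6
    have h7 := congrFun hw 7
    simp [Matrix.vecMul, dotProduct, Fin.sum_univ_six] at h0 h1 h2 h3 h4 h5 h6 h7
    rcases hxyz with hx | hy | hz
    · refine ⟨w 0 / x ^ 2, ?_⟩
      ext i
      fin_cases i <;> simp <;> grind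
    · refine ⟨w 1 / y ^ 2, ?_⟩
      ext i
      fin_cases i <;> simp <;> grind
    · refine ⟨w 2 / z ^ 2, ?_⟩
      ext i
      fin_cases i <;> simp <;> grind
  · rintro ⟨c, rfl⟩
    ext j
    fin_cases j <;> simp [Matrix.vecMul, dotProduct, Fin.sum_univ_six] <;> ring
end

section
/- Let E = ℂ⁵ and let δ = δ₀ + δ₂ + δ₄ ∈ Δ₊ with δ₀ ∈ ⋀⁰E = ℂ, δ₂ ∈ ⋀²E, δ₄ ∈ ⋀⁴E. Assume δ₀ ≠ 0 and ω := δ₀·δ₄ − (1/2)·δ₂ ∧ δ₂ ≠ 0 in ⋀⁴E. Then the kernel of ψ_δ : E ⊕ E* → Δ₋ is one-dimensional; explicitly, {f ∈ E* : f ⌟ ω = 0} is a one-dimensional subspace of E*, and ker ψ_δ = { ( −δ₀⁻¹·(f ⌟ δ₂), f ) : f ∈ E*, f ⌟ ω = 0 }. -/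
open Module LinearMap ExteriorAlgebra

variable {E : Type*} [AddCommGroup E] [Module ℂ E]

/-- For `δ` in the exterior algebra of `E`, the linear map
`ψ_δ : E ⊕ E* → ⋀E`, `(e, f) ↦ e ∧ δ + f ⌟ δ`. -/
noncomputable def psi (δ : ExteriorAlgebra ℂ E) :
    E × Module.Dual ℂ E →ₗ[ℂ] ExteriorAlgebra ℂ E :=
  ((LinearMap.mulRight ℂ δ) ∘ₗ ι ℂ) ∘ₗ (LinearMap.fst ℂ E (Module.Dual ℂ E))
    + ((CliffordAlgebra.contractLeft (Q := (0 : QuadraticForm ℂ E))).flip δ) ∘ₗ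
        (LinearMap.snd ℂ E (Module.Dual ℂ E))

open CliffordAlgebra in
lemma contractLeft_mem_exteriorPower (f : Module.Dual ℂ E) (n : ℕ) {x : ExteriorAlgebra ℂ E}
    (hx : x ∈ ⋀[ℂ]^(n + 1) E) :
    contractLeft (Q := (0 : QuadraticForm ℂ E)) f x ∈ ⋀[ℂ]^n E := by
  induction n generalizing x with
  | zero =>
    rw [zero_add, exteriorPower, pow_one] at hx
    obtain ⟨v, rfl⟩ := hx
    rw [exteriorPower, pow_zero, contractLeft_ι]
    exact Submodule.algebraMap_mem _
  | succ n ih =>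
    rw [exteriorPower, pow_succ'] at hx
    induction hx using Submodule.mul_induction_on' with
    | mem_mul_mem m hm y hy =>
      obtain ⟨v, rfl⟩ := hm
      rw [contractLeft_ι_mul]
      refine Submodule.sub_mem _ (Submodule.smul_mem _ _ hy) ?_
      rw [exteriorPower, pow_succ']
      exact Submodule.mul_mem_mul ⟨v, rfl⟩ (ih hy)
    | add y _ z _ hy hz =>
      rw [map_add]
      exact Submodule.add_mem _ hy hz

/-- Contraction satisfies the Leibniz rule without sign past an element of degree two. -/
lemma contractLeft_mul_of_mem_two (f : Module.Dual ℂ E) {a : ExteriorAlgebra ℂ E}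
    (ha : a ∈ ⋀[ℂ]^2 E) (b : ExteriorAlgebra ℂ E) :
    CliffordAlgebra.contractLeft (Q := (0 : QuadraticForm ℂ E)) f (a * b) =
      CliffordAlgebra.contractLeft (Q := (0 : QuadraticForm ℂ E)) f a * b +
        a * CliffordAlgebra.contractLeft (Q := (0 : QuadraticForm ℂ E)) f b := by
  rw [exteriorPower, pow_two] at ha
  induction ha using Submodule.mul_induction_on' with
  | mem_mul_mem m hm y hy =>
    obtain ⟨v, rfl⟩ := hm
    obtain ⟨w, rfl⟩ := hy
    simp only [mul_assoc, CliffordAlgebra.contractLeft_ι_mul, CliffordAlgebra.contractLeft_ι,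
      mul_sub, sub_mul, smul_mul_assoc, mul_smul_comm, ← Algebra.commutes, ← Algebra.smul_def]
    abel
  | add y _ z _ hy hz =>
    simp only [add_mul, map_add, hy, hz]
    abel

lemma ι_mul_ι_eq_neg (x y : E) : ι ℂ x * ι ℂ y = -(ι ℂ y * ι ℂ x) :=
  eq_neg_of_add_eq_zero_left (ι_add_mul_swap x y)

lemma ι_mul_comm_of_mem_two (x : E) {a : ExteriorAlgebra ℂ E} (ha : a ∈ ⋀[ℂ]^2 E) :
    a * ι ℂ x = ι ℂ x * a := by
  rw [exteriorPower, pow_two] at ha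
  induction ha using Submodule.mul_induction_on' with
  | mem_mul_mem m hm y hy =>
    obtain ⟨v, rfl⟩ := hm
    obtain ⟨w, rfl⟩ := hy
    rw [mul_assoc, ι_mul_ι_eq_neg w x, mul_neg, ← mul_assoc, ι_mul_ι_eq_neg v x, neg_mul, neg_neg,
      mul_assoc]
  | add y _ z _ hy hz => rw [add_mul, mul_add, hy, hz]

lemma exteriorPower_eq_zero_of_finrank_lt [FiniteDimensional ℂ E] {n : ℕ} (hn : finrank ℂ E < n)
    {x : ExteriorAlgebra ℂ E} (hx : x ∈ ⋀[ℂ]^n E) : x = 0 := by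
  have h : finrank ℂ (⋀[ℂ]^n E) = 0 := by
    rw [exteriorPower.finrank_eq, Nat.choose_eq_zero_of_lt hn]
  rw [Submodule.finrank_eq_zero] at h
  rwa [h, Submodule.mem_bot] at hx

lemma ι_mul_mem_exteriorPower (v : E) {n : ℕ} {x : ExteriorAlgebra ℂ E} (hx : x ∈ ⋀[ℂ]^n E) :
    ι ℂ v * x ∈ ⋀[ℂ]^(n + 1) E := by
  rw [exteriorPower, pow_succ']
  exact Submodule.mul_mem_mul ⟨v, rfl⟩ hx

lemma exteriorPower_mul_mem {m n : ℕ} {x y : ExteriorAlgebra ℂ E} (hx : x ∈ ⋀[ℂ]^m E)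
    (hy : y ∈ ⋀[ℂ]^n E) : x * y ∈ ⋀[ℂ]^(m + n) E := by
  rw [exteriorPower, pow_add]
  exact Submodule.mul_mem_mul hx hy

lemma eq_zero_of_add_eq_zero_of_degrees {i j k : ℕ} (hij : i ≠ j) (hik : i ≠ k) (hjk : j ≠ k)
    {x y z : ExteriorAlgebra ℂ E}
    (hx : x ∈ ⋀[ℂ]^i E) (hy : y ∈ ⋀[ℂ]^j E) (hz : z ∈ ⋀[ℂ]^k E) (h : x + y + z = 0) :
    x = 0 ∧ y = 0 ∧ z = 0 := by
  have key (n : ℕ) := congrArg (GradedRing.proj (fun i : ℕ ↦ ⋀[ℂ]^i E) n) h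
  simp only [map_add, map_zero, GradedRing.proj_apply] at key
  refine ⟨?_, ?_, ?_⟩
  · simpa [DirectSum.decompose_of_mem_same (fun i : ℕ ↦ ⋀[ℂ]^i E) hx, DirectSum.decompose_of_mem_ne (fun i : ℕ ↦ ⋀[ℂ]^i E) hy hij.symm,
      DirectSum.decompose_of_mem_ne (fun i : ℕ ↦ ⋀[ℂ]^i E) hz hik.symm] using key i
  · simpa [DirectSum.decompose_of_mem_same (fun i : ℕ ↦ ⋀[ℂ]^i E) hy, DirectSum.decompose_of_mem_ne (fun i : ℕ ↦ ⋀[ℂ]^i E) hx hij,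
      DirectSum.decompose_of_mem_ne (fun i : ℕ ↦ ⋀[ℂ]^i E) hz hjk.symm] using key j
  · simpa [DirectSum.decompose_of_mem_same (fun i : ℕ ↦ ⋀[ℂ]^i E) hz, DirectSum.decompose_of_mem_ne (fun i : ℕ ↦ ⋀[ℂ]^i E) hx hik,
      DirectSum.decompose_of_mem_ne (fun i : ℕ ↦ ⋀[ℂ]^i E) hy hjk] using key k

/-- A nonzero element of codegree one is annihilated by exactly one line of functionals. -/
lemma exists_ker_contractLeft_eq_span [FiniteDimensional ℂ E] {n : ℕ} (hE : finrank ℂ E = n + 1)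
    {ω : ExteriorAlgebra ℂ E} (hω : ω ∈ ⋀[ℂ]^n E) (hω0 : ω ≠ 0) :
    ∃ g : Module.Dual ℂ E, g ≠ 0 ∧
      LinearMap.ker ((CliffordAlgebra.contractLeft (Q := (0 : QuadraticForm ℂ E))).flip ω) =
        Submodule.span ℂ {g} := by
  obtain ⟨vol, hvol, hvol0⟩ : ∃ vol ∈ ⋀[ℂ]^(n + 1) E, vol ≠ 0 := by
    refine Submodule.exists_mem_ne_zero_of_ne_bot fun h ↦ ?_
    have h1 : finrank ℂ (⋀[ℂ]^(n + 1) E) = 1 := by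
      rw [exteriorPower.finrank_eq, hE, Nat.choose_self]
    rw [h, finrank_bot] at h1
    exact zero_ne_one h1
  have ι_mul_contract (e : E) (f : Module.Dual ℂ E) :
      ι ℂ e * CliffordAlgebra.contractLeft (Q := (0 : QuadraticForm ℂ E)) f vol = f e • vol := by
    have h := CliffordAlgebra.contractLeft_ι_mul (Q := (0 : QuadraticForm ℂ E)) (d := f) e vol
    rw [exteriorPower_eq_zero_of_finrank_lt (n := n + 1 + 1) (by lia)
      (ι_mul_mem_exteriorPower e hvol), map_zero] at h
    exact (sub_eq_zero.mp h.symm).symm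
  let T : Module.Dual ℂ E →ₗ[ℂ] ⋀[ℂ]^n E :=
    ((CliffordAlgebra.contractLeft (Q := (0 : QuadraticForm ℂ E))).flip vol).codRestrict _
      fun f ↦ contractLeft_mem_exteriorPower f n hvol
  have hT : Function.Injective T := by
    rw [injective_iff_map_eq_zero]
    intro f hf
    ext e
    have h := ι_mul_contract e f
    have hf' : CliffordAlgebra.contractLeft (Q := (0 : QuadraticForm ℂ E)) f vol = 0 :=
      congrArg Subtype.val hf
    rw [hf', mul_zero] at h
    simpa [hvol0] using h.symm
  have hdim : finrank ℂ (Module.Dual ℂ E) = finrank ℂ (⋀[ℂ]^n E) := by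
    rw [Subspace.dual_finrank_eq, exteriorPower.finrank_eq, hE, Nat.choose_succ_self_right]
  obtain ⟨g, hg⟩ := (LinearMap.injective_iff_surjective_of_finrank_eq_finrank hdim).mp hT ⟨ω, hω⟩
  have hg' : CliffordAlgebra.contractLeft (Q := (0 : QuadraticForm ℂ E)) g vol = ω :=
    congrArg Subtype.val hg
  have hg0 : g ≠ 0 := by
    rintro rfl
    exact hω0 (by simpa using hg'.symm)
  refine ⟨g, hg0, le_antisymm (fun f hf ↦ ?_) ?_⟩
  · have hf' : CliffordAlgebra.contractLeft (Q := (0 : QuadraticForm ℂ E)) f ω = 0 := hf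
    obtain ⟨e, he⟩ : ∃ e, g e ≠ 0 := by
      by_contra! h
      exact hg0 (LinearMap.ext h)
    have h := CliffordAlgebra.contractLeft_ι_mul (Q := (0 : QuadraticForm ℂ E)) (d := f) e ω
    rw [hf', mul_zero, sub_zero, ← hg'] at h
    erw [ι_mul_contract e g] at h
    rw [map_smul] at h
    have h2 : g e • f = f e • g := hT (by rw [map_smul, map_smul]; exact Subtype.ext h)
    refine Submodule.mem_span_singleton.mpr ⟨(g e)⁻¹ * f e, ?_⟩
    rw [mul_smul, ← h2, inv_smul_smul₀ he]
  · rw [Submodule.span_singleton_le_iff_mem, LinearMap.mem_ker, LinearMap.flip_apply, ← hg',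
      CliffordAlgebra.contractLeft_contractLeft]

/-- The kernel of `psi` is described by its components in degrees one and three; the degree five
component of the equation is then automatic. -/
lemma mem_ker_psi_iff [FiniteDimensional ℂ E] (hE : finrank ℂ E = 5)
    {δ₀ : ℂ} (hδ₀ : δ₀ ≠ 0)
    {δ₂ : ExteriorAlgebra ℂ E} (hδ₂ : δ₂ ∈ ⋀[ℂ]^2 E)
    {δ₄ : ExteriorAlgebra ℂ E} (hδ₄ : δ₄ ∈ ⋀[ℂ]^4 E) (p : E × Module.Dual ℂ E) :
    p ∈ LinearMap.ker (psi (algebraMap ℂ (ExteriorAlgebra ℂ E) δ₀ + δ₂ + δ₄)) ↔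
      CliffordAlgebra.contractLeft (Q := (0 : QuadraticForm ℂ E)) p.2
          (δ₀ • δ₄ - (2⁻¹ : ℂ) • (δ₂ * δ₂)) = 0 ∧
        ι ℂ p.1 = -δ₀⁻¹ •
          CliffordAlgebra.contractLeft (Q := (0 : QuadraticForm ℂ E)) p.2 δ₂ := by
  obtain ⟨e, f⟩ := p
  let c : ExteriorAlgebra ℂ E →ₗ[ℂ] ExteriorAlgebra ℂ E :=
    CliffordAlgebra.contractLeft (Q := (0 : QuadraticForm ℂ E)) f
  change _ ↔ c (δ₀ • δ₄ - (2⁻¹ : ℂ) • (δ₂ * δ₂)) = 0 ∧ ι ℂ e = -δ₀⁻¹ • c δ₂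
  have hψ : psi (algebraMap ℂ (ExteriorAlgebra ℂ E) δ₀ + δ₂ + δ₄) (e, f) =
      (δ₀ • ι ℂ e + c δ₂) + (ι ℂ e * δ₂ + c δ₄) + ι ℂ e * δ₄ := by
    have h0 : c (algebraMap ℂ (ExteriorAlgebra ℂ E) δ₀) = 0 :=
      CliffordAlgebra.contractLeft_algebraMap (Q := (0 : QuadraticForm ℂ E)) (d := f) δ₀
    change ι ℂ e * (algebraMap ℂ (ExteriorAlgebra ℂ E) δ₀ + δ₂ + δ₄) +
      c (algebraMap ℂ (ExteriorAlgebra ℂ E) δ₀ + δ₂ + δ₄) = _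
    rw [map_add, map_add, h0, mul_add, mul_add, ← Algebra.commutes, ← Algebra.smul_def]
    abel
  have hc₂ : c δ₂ ∈ ⋀[ℂ]^1 E := contractLeft_mem_exteriorPower f 1 hδ₂
  have degree_one : δ₀ • ι ℂ e + c δ₂ = 0 ↔ ι ℂ e = -δ₀⁻¹ • c δ₂ := by
    rw [neg_smul, ← smul_neg, eq_inv_smul_iff₀ hδ₀, eq_neg_iff_add_eq_zero]
  have degree_three (he : δ₀ • ι ℂ e + c δ₂ = 0) :
      c (δ₀ • δ₄ - (2⁻¹ : ℂ) • (δ₂ * δ₂)) = δ₀ • (ι ℂ e * δ₂ + c δ₄) := by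
    have hcc : c (δ₂ * δ₂) = c δ₂ * δ₂ + δ₂ * c δ₂ := contractLeft_mul_of_mem_two f hδ₂ δ₂
    have he' : c δ₂ = -(δ₀ • ι ℂ e) := eq_neg_of_add_eq_zero_right he
    rw [map_sub, map_smul, map_smul, hcc, he', mul_neg, mul_smul_comm,
      ι_mul_comm_of_mem_two e hδ₂, neg_mul, smul_mul_assoc]
    module
  rw [LinearMap.mem_ker, hψ, ← degree_one]
  constructor
  · intro h
    obtain ⟨h1, h3, -⟩ := eq_zero_of_add_eq_zero_of_degrees (i := 1) (j := 3) (k := 5)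
      (by decide) (by decide) (by decide)
      (Submodule.add_mem _ (Submodule.smul_mem _ _ (by rw [exteriorPower, pow_one]; exact ⟨e, rfl⟩)) hc₂)
      (Submodule.add_mem _ (ι_mul_mem_exteriorPower e hδ₂)
        (contractLeft_mem_exteriorPower f 3 hδ₄))
      (ι_mul_mem_exteriorPower e hδ₄) h
    exact ⟨by rw [degree_three h1, h3, smul_zero], h1⟩
  · rintro ⟨h3, h1⟩
    rw [degree_three h1, smul_eq_zero_iff_right hδ₀] at h3
    have he' : c δ₂ = -(δ₀ • ι ℂ e) := eq_neg_of_add_eq_zero_right h1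
    have hc₄ : c δ₄ = -(ι ℂ e * δ₂) := eq_neg_of_add_eq_zero_right h3
    have h24 : c (δ₂ * δ₄) = 0 := by
      rw [exteriorPower_eq_zero_of_finrank_lt (n := 6) (by lia) (exteriorPower_mul_mem hδ₂ hδ₄),
        map_zero]
    have h222 : c (δ₂ * (δ₂ * δ₂)) = 0 := by
      rw [exteriorPower_eq_zero_of_finrank_lt (n := 6) (by lia)
        (exteriorPower_mul_mem hδ₂ (exteriorPower_mul_mem hδ₂ hδ₂)), map_zero]
    have leibniz (b : ExteriorAlgebra ℂ E) : c (δ₂ * b) = c δ₂ * b + δ₂ * c b :=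
      contractLeft_mul_of_mem_two f hδ₂ b
    have hcomm := ι_mul_comm_of_mem_two e hδ₂
    have hcomm' : δ₂ * (ι ℂ e * δ₂) = ι ℂ e * (δ₂ * δ₂) := by
      rw [← mul_assoc, hcomm, mul_assoc]
    have he22 : ι ℂ e * (δ₂ * δ₂) = 0 := by
      simp only [leibniz, he', mul_add, neg_mul, mul_neg, smul_mul_assoc, mul_smul_comm, hcomm,
        hcomm'] at h222
      have : (-3 * δ₀) • (ι ℂ e * (δ₂ * δ₂)) = 0 := by
        rw [← h222]
        module
      exact (smul_eq_zero_iff_right (mul_ne_zero (by norm_num) hδ₀)).mp this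
    rw [leibniz, he', hc₄, mul_neg, hcomm', he22, neg_zero, add_zero, neg_mul, smul_mul_assoc,
      neg_eq_zero, smul_eq_zero_iff_right hδ₀] at h24
    rw [h1, h3, h24, add_zero, add_zero]

/-- Let `dim E = 5` and `δ = δ₀ + δ₂ + δ₄ ∈ Δ₊ = ⋀⁰E ⊕ ⋀²E ⊕ ⋀⁴E` with `δ₀ ≠ 0` and
`ω = δ₀·δ₄ − ½·δ₂∧δ₂ ≠ 0`. Then `{f ∈ E* : f ⌟ ω = 0}` is one-dimensional, the kernel of
`ψ_δ : E ⊕ E* → Δ₋` is one-dimensional, and it consists exactly of the pairs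
`(−δ₀⁻¹·(f ⌟ δ₂), f)` with `f ⌟ ω = 0`. -/
theorem ker_psi_dim_one
    [FiniteDimensional ℂ E] (hE : finrank ℂ E = 5)
    (δ₀ : ℂ) (hδ₀ : δ₀ ≠ 0)
    (δ₂ : ExteriorAlgebra ℂ E) (hδ₂ : δ₂ ∈ ⋀[ℂ]^2 E)
    (δ₄ : ExteriorAlgebra ℂ E) (hδ₄ : δ₄ ∈ ⋀[ℂ]^4 E)
    (hω : δ₀ • δ₄ - (2⁻¹ : ℂ) • (δ₂ * δ₂) ≠ 0) :
    finrank ℂ (LinearMap.ker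
        ((CliffordAlgebra.contractLeft (Q := (0 : QuadraticForm ℂ E))).flip
          (δ₀ • δ₄ - (2⁻¹ : ℂ) • (δ₂ * δ₂)))) = 1 ∧
      finrank ℂ (LinearMap.ker (psi (algebraMap ℂ (ExteriorAlgebra ℂ E) δ₀ + δ₂ + δ₄))) = 1 ∧
      (LinearMap.ker (psi (algebraMap ℂ (ExteriorAlgebra ℂ E) δ₀ + δ₂ + δ₄)) :
          Set (E × Module.Dual ℂ E)) =
        {p : E × Module.Dual ℂ E |
          CliffordAlgebra.contractLeft (Q := (0 : QuadraticForm ℂ E)) p.2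
              (δ₀ • δ₄ - (2⁻¹ : ℂ) • (δ₂ * δ₂)) = 0 ∧
            ι ℂ p.1 = -δ₀⁻¹ •
              CliffordAlgebra.contractLeft (Q := (0 : QuadraticForm ℂ E)) p.2 δ₂} := by
  have hω4 : δ₀ • δ₄ - (2⁻¹ : ℂ) • (δ₂ * δ₂) ∈ ⋀[ℂ]^4 E :=
    Submodule.sub_mem _ (Submodule.smul_mem _ _ hδ₄)
      (Submodule.smul_mem _ _ (exteriorPower_mul_mem hδ₂ hδ₂))
  obtain ⟨g, hg0, hg⟩ := exists_ker_contractLeft_eq_span hE hω4 hω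
  have hmem := mem_ker_psi_iff hE hδ₀ hδ₂ hδ₄
  refine ⟨by rw [hg, finrank_span_singleton hg0], ?_, Set.ext hmem⟩
  obtain ⟨v, hv⟩ : CliffordAlgebra.contractLeft (Q := (0 : QuadraticForm ℂ E)) g δ₂ ∈
      LinearMap.range (ι ℂ (M := E)) := by
    simpa only [exteriorPower, pow_one] using contractLeft_mem_exteriorPower g 1 hδ₂
  have hker : LinearMap.ker (psi (algebraMap ℂ (ExteriorAlgebra ℂ E) δ₀ + δ₂ + δ₄)) =
      Submodule.span ℂ {(-δ₀⁻¹ • v, g)} := by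
    refine le_antisymm (fun p hp ↦ ?_) ?_
    · obtain ⟨hp2, hp1⟩ := (hmem p).mp hp
      have hp2' : p.2 ∈ Submodule.span ℂ {g} := hg ▸ hp2
      obtain ⟨t, ht⟩ := Submodule.mem_span_singleton.mp hp2'
      refine Submodule.mem_span_singleton.mpr ⟨t, Prod.ext ((ι_leftInverse (R := ℂ)).injective ?_) ht⟩
      rw [hp1, ← ht, map_smul, LinearMap.smul_apply, ← hv, Prod.smul_fst, map_smul, map_smul,
        smul_comm]
    · rw [Submodule.span_singleton_le_iff_mem, hmem]
      refine ⟨?_, by rw [map_smul, hv]⟩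
      have : g ∈ Submodule.span ℂ {g} := Submodule.mem_span_singleton_self g
      rwa [← hg] at this
  rw [hker, finrank_span_singleton fun h ↦ hg0 (congrArg Prod.snd h)]
end

section
/- Let E = ℂ⁵. For every δ ∈ Δ₊ = ⋀⁰E ⊕ ⋀²E ⊕ ⋀⁴E, the linear map ψ_δ : E ⊕ E* → Δ₋ = ⋀¹E ⊕ ⋀³E ⊕ ⋀⁵E, ψ_δ(e,f) = e ∧ δ + f ⌟ δ, has a nontrivial kernel: there exists a nonzero pair (e,f) ∈ E ⊕ E* with e ∧ δ + f ⌟ δ = 0. Equivalently, rank ψ_δ ≤ 9 for every δ ∈ Δ₊, so {ψ_δ : δ ∈ Δ₊} is a 16-dimensional space of linear maps of bounded rank 9. -/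
open Module LinearMap ExteriorAlgebra

variable {E : Type*} [AddCommGroup E] [Module ℂ E]

local notation:75 f:76 "⌟" x:75 => CliffordAlgebra.contractLeft (Q := 0) f x

section CommRing

variable {R M : Type*} [CommRing R] [AddCommGroup M] [Module R M]

lemma contractLeft_ι_mul' (f : Dual R M) (a : M) (x : ExteriorAlgebra R M) :
    f ⌟ (ι R a * x) = f a • x - ι R a * (f ⌟ x) :=
  CliffordAlgebra.contractLeft_ι_mul f a x

lemma ι_mul_ι_anticomm (a b : M) : ι R a * ι R b = -(ι R b * ι R a) :=
  eq_neg_of_add_eq_zero_left (ι_add_mul_swap a b)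

@[elab_as_elim]
lemma exteriorPower_two_induction {p : ExteriorAlgebra R M → Prop}
    (ι_mul_ι : ∀ a b, p (ι R a * ι R b)) (add : ∀ x y, p x → p y → p (x + y))
    {ω : ExteriorAlgebra R M} (hω : ω ∈ ⋀[R]^2 M) : p ω := by
  rw [exteriorPower, pow_two] at hω
  induction hω using Submodule.mul_induction_on' with
  | mem_mul_mem x hx y hy =>
    obtain ⟨a, rfl⟩ := hx
    obtain ⟨b, rfl⟩ := hy
    exact ι_mul_ι a b
  | add x _ y _ hx hy => exact add x y hx hy

lemma mul_ι_of_mem_exteriorPower_two {ω : ExteriorAlgebra R M} (hω : ω ∈ ⋀[R]^2 M) (c : M) :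
    ω * ι R c = ι R c * ω := by
  refine exteriorPower_two_induction (fun a b ↦ ?_) (fun x y hx hy ↦ ?_) hω
  · rw [mul_assoc, ι_mul_ι_anticomm b c, mul_neg, ← mul_assoc, ι_mul_ι_anticomm a c, neg_mul,
      neg_neg, mul_assoc]
  · rw [add_mul, mul_add, hx, hy]

lemma exists_contractLeft_eq_ι_of_mem_exteriorPower_two {ω : ExteriorAlgebra R M}
    (hω : ω ∈ ⋀[R]^2 M) (f : Dual R M) : ∃ a, f ⌟ ω = ι R a := by
  refine exteriorPower_two_induction (fun a b ↦ ?_) (fun x y hx hy ↦ ?_) hω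
  · refine ⟨f a • b - f b • a, ?_⟩
    rw [contractLeft_ι_mul', CliffordAlgebra.contractLeft_ι, ← Algebra.commutes,
      ← Algebra.smul_def, map_sub, map_smul, map_smul]
  · obtain ⟨a, ha⟩ := hx
    obtain ⟨b, hb⟩ := hy
    exact ⟨a + b, by rw [map_add, map_add, ha, hb]⟩

lemma contractLeft_mul_of_mem_exteriorPower_two {ω : ExteriorAlgebra R M}
    (hω : ω ∈ ⋀[R]^2 M) (f : Dual R M) (x : ExteriorAlgebra R M) :
    f ⌟ (ω * x) = (f ⌟ ω) * x + ω * (f ⌟ x) := by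
  refine exteriorPower_two_induction (fun a b ↦ ?_) (fun x y hx hy ↦ ?_) hω
  · rw [mul_assoc, contractLeft_ι_mul', contractLeft_ι_mul', contractLeft_ι_mul',
      CliffordAlgebra.contractLeft_ι, ← Algebra.commutes, ← Algebra.smul_def]
    simp only [mul_sub, sub_mul, mul_smul_comm, smul_mul_assoc, mul_assoc]
    abel
  · simp only [add_mul, map_add, hx, hy]
    abel

lemma contractLeft_mem_exteriorPower_s11 (f : Dual R M) (n : ℕ) {x : ExteriorAlgebra R M}
    (hx : x ∈ ⋀[R]^(n + 1) M) : f ⌟ x ∈ ⋀[R]^n M := by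
  induction n generalizing x with
  | zero =>
    rw [exteriorPower, zero_add, pow_one] at hx
    obtain ⟨a, rfl⟩ := hx
    rw [CliffordAlgebra.contractLeft_ι, exteriorPower, pow_zero]
    exact Submodule.algebraMap_mem _
  | succ n ih =>
    rw [exteriorPower, pow_succ'] at hx
    induction hx using Submodule.mul_induction_on' with
    | mem_mul_mem y hy z hz =>
      obtain ⟨a, rfl⟩ := hy
      rw [contractLeft_ι_mul']
      refine Submodule.sub_mem _ (Submodule.smul_mem _ _ hz) ?_
      rw [exteriorPower, pow_succ']
      exact Submodule.mul_mem_mul ⟨a, rfl⟩ (ih hz)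
    | add y _ z _ hy hz =>
      rw [map_add]
      exact Submodule.add_mem _ hy hz

lemma mul_mem_exteriorPower {m n : ℕ} {x y : ExteriorAlgebra R M} (hx : x ∈ ⋀[R]^m M)
    (hy : y ∈ ⋀[R]^n M) : x * y ∈ ⋀[R]^(m + n) M := by
  rw [exteriorPower, pow_add]
  exact Submodule.mul_mem_mul hx hy

lemma contractLeft_sq_of_mem_exteriorPower_two {ω : ExteriorAlgebra R M} (hω : ω ∈ ⋀[R]^2 M)
    (f : Dual R M) : f ⌟ (ω * ω) = (2 : R) • ((f ⌟ ω) * ω) := by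
  obtain ⟨a, ha⟩ := exists_contractLeft_eq_ι_of_mem_exteriorPower_two hω f
  rw [contractLeft_mul_of_mem_exteriorPower_two hω, ha, mul_ι_of_mem_exteriorPower_two hω, two_smul]

lemma contractLeft_cube_of_mem_exteriorPower_two {ω : ExteriorAlgebra R M} (hω : ω ∈ ⋀[R]^2 M)
    (f : Dual R M) : f ⌟ (ω * (ω * ω)) = (3 : R) • (ω * ((f ⌟ ω) * ω)) := by
  obtain ⟨a, ha⟩ := exists_contractLeft_eq_ι_of_mem_exteriorPower_two hω f
  have hcomm : ω * (ι R a * ω) = ι R a * (ω * ω) := by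
    rw [← mul_assoc, mul_ι_of_mem_exteriorPower_two hω, mul_assoc]
  rw [contractLeft_mul_of_mem_exteriorPower_two hω, contractLeft_sq_of_mem_exteriorPower_two hω,
    ha, mul_smul_comm, hcomm]
  module

/-- The degree `1`, `3` and `5` components of `e ∧ (c + ω + η) + f ⌟ (c + ω + η) = 0`. -/
lemma ι_mul_add_contractLeft_eq_zero {c : R} {ω η : ExteriorAlgebra R M} {e : M} {f : Dual R M}
    (h₁ : c • ι R e + f ⌟ ω = 0) (h₃ : ι R e * ω + f ⌟ η = 0) (h₅ : ι R e * η = 0) :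
    ι R e * (algebraMap R _ c + ω + η) + f ⌟ (algebraMap R _ c + ω + η) = 0 := by
  rw [map_add, map_add, CliffordAlgebra.contractLeft_algebraMap, mul_add, mul_add,
    ← Algebra.commutes, ← Algebra.smul_def, h₅]
  calc _ = (c • ι R e + f ⌟ ω) + (ι R e * ω + f ⌟ η) := by abel
    _ = 0 := by rw [h₁, h₃, add_zero]

end CommRing

section Field

variable {K V : Type*} [Field K] [AddCommGroup V] [Module K V] [FiniteDimensional K V]

lemma eq_zero_of_mem_exteriorPower_of_finrank_lt {n : ℕ} (hn : finrank K V < n)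
    {x : ExteriorAlgebra K V} (hx : x ∈ ⋀[K]^n V) : x = 0 := by
  have h : finrank K (⋀[K]^n V) = 0 := by
    rw [exteriorPower.finrank_eq, Nat.choose_eq_zero_of_lt hn]
  rw [Submodule.finrank_eq_zero] at h
  rwa [h, Submodule.mem_bot] at hx

lemma exists_forall_mem_exteriorPower_eq_contractLeft {n : ℕ} (hn : finrank K V = n + 1) :
    ∃ vol ∈ ⋀[K]^(n + 1) V, ∀ x ∈ ⋀[K]^n V, ∃ f : Dual K V, x = f ⌟ vol := by
  have htop : finrank K (⋀[K]^(n + 1) V) = 1 := by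
    rw [exteriorPower.finrank_eq, hn, Nat.choose_self]
  obtain ⟨vol, hvol, hvol0⟩ : ∃ vol ∈ ⋀[K]^(n + 1) V, vol ≠ 0 := by
    refine Submodule.exists_mem_ne_zero_of_ne_bot fun h ↦ ?_
    rw [h, finrank_bot] at htop
    exact zero_ne_one htop
  refine ⟨vol, hvol, ?_⟩
  let φ : Dual K V →ₗ[K] ⋀[K]^n V :=
    ((CliffordAlgebra.contractLeft (Q := (0 : QuadraticForm K V))).flip vol).codRestrict _
      fun f ↦ contractLeft_mem_exteriorPower_s11 f n hvol
  have hinj : Function.Injective φ := by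
    refine (injective_iff_map_eq_zero φ).2 fun f hf ↦ LinearMap.ext fun a ↦ ?_
    have hf' : f ⌟ vol = 0 := congrArg Subtype.val hf
    have hmul : ι K a * vol = 0 := by
      refine eq_zero_of_mem_exteriorPower_of_finrank_lt (n := 1 + (n + 1)) (by omega)
        (mul_mem_exteriorPower ?_ hvol)
      rw [exteriorPower, pow_one]
      exact ⟨a, rfl⟩
    have h := contractLeft_ι_mul' f a vol
    rw [hmul, hf', map_zero, mul_zero, sub_zero] at h
    exact (smul_eq_zero.1 h.symm).resolve_right hvol0
  have hdim : finrank K (Dual K V) = finrank K (⋀[K]^n V) := by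
    rw [Subspace.dual_finrank_eq, exteriorPower.finrank_eq, hn, Nat.choose_succ_self_right]
  intro x hx
  obtain ⟨f, hf⟩ := (LinearMap.injective_iff_surjective_of_finrank_eq_finrank hdim).1 hinj ⟨x, hx⟩
  exact ⟨f, (congrArg Subtype.val hf).symm⟩

lemma exists_ne_zero_contractLeft_eq_zero {n : ℕ} (hn : finrank K V = n + 1)
    {x : ExteriorAlgebra K V} (hx : x ∈ ⋀[K]^n V) : ∃ f : Dual K V, f ≠ 0 ∧ f ⌟ x = 0 := by
  obtain ⟨vol, -, hsurj⟩ := exists_forall_mem_exteriorPower_eq_contractLeft hn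
  obtain ⟨f, rfl⟩ := hsurj x hx
  by_cases hf : f = 0
  · have : Nontrivial (Dual K V) := by
      apply nontrivial_of_finrank_pos (R := K)
      rw [Subspace.dual_finrank_eq, hn]
      exact n.succ_pos
    obtain ⟨g, hg⟩ := exists_ne (0 : Dual K V)
    exact ⟨g, hg, by simp [hf]⟩
  · exact ⟨f, hf, CliffordAlgebra.contractLeft_contractLeft ..⟩

lemma contractLeft_mul_eq_neg (hV : finrank K V < 6) {ω η : ExteriorAlgebra K V}
    (hω : ω ∈ ⋀[K]^2 V) (hη : η ∈ ⋀[K]^4 V) (f : Dual K V) :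
    (f ⌟ ω) * η = -(ω * (f ⌟ η)) := by
  have h := contractLeft_mul_of_mem_exteriorPower_two hω f η
  rw [eq_zero_of_mem_exteriorPower_of_finrank_lt hV (mul_mem_exteriorPower hω hη), map_zero] at h
  exact eq_neg_of_add_eq_zero_left h.symm

lemma exists_ker_of_scalar_ne_zero [CharZero K] (hV : finrank K V = 5) {c : K} (hc : c ≠ 0)
    {ω η : ExteriorAlgebra K V} (hω : ω ∈ ⋀[K]^2 V) (hη : η ∈ ⋀[K]^4 V) :
    ∃ p : V × Dual K V, p ≠ 0 ∧
      ι K p.1 * (algebraMap K _ c + ω + η) + p.2 ⌟ (algebraMap K _ c + ω + η) = 0 := by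
  have hω2 : ω * ω ∈ ⋀[K]^4 V := mul_mem_exteriorPower hω hω
  obtain ⟨f, hf0, hf⟩ := exists_ne_zero_contractLeft_eq_zero hV
    (Submodule.sub_mem _ (Submodule.smul_mem _ (2 * c) hη) hω2)
  obtain ⟨a, ha⟩ := exists_contractLeft_eq_ι_of_mem_exteriorPower_two hω f
  have hη' : f ⌟ η = c⁻¹ • (ι K a * ω) := by
    rw [map_sub, map_smul, contractLeft_sq_of_mem_exteriorPower_two hω, ha, mul_smul, ← smul_sub,
      smul_eq_zero_iff_right two_ne_zero, sub_eq_zero] at hf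
    rw [← hf, inv_smul_smul₀ hc]
  have hcube : ω * (ι K a * ω) = 0 := by
    have h := contractLeft_cube_of_mem_exteriorPower_two hω f
    rw [eq_zero_of_mem_exteriorPower_of_finrank_lt (by omega) (mul_mem_exteriorPower hω hω2),
      map_zero, ha] at h
    exact (smul_eq_zero_iff_right three_ne_zero).1 h.symm
  refine ⟨(-c⁻¹ • a, f), fun h ↦ hf0 (congrArg Prod.snd h),
    ι_mul_add_contractLeft_eq_zero ?_ ?_ ?_⟩
  · rw [map_smul, ha, neg_smul, smul_neg, smul_inv_smul₀ hc, neg_add_cancel]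
  · rw [map_smul, smul_mul_assoc, hη', neg_smul, neg_add_cancel]
  · rw [map_smul, smul_mul_assoc, ← ha, contractLeft_mul_eq_neg (by omega) hω hη, hη',
      mul_smul_comm, hcube, smul_zero, neg_zero, smul_zero]

lemma exists_ker_of_sq_eq_zero [CharZero K] (hV : finrank K V = 5)
    {ω η : ExteriorAlgebra K V} (hω : ω ∈ ⋀[K]^2 V) (hη : η ∈ ⋀[K]^4 V) (hsq : ω * ω = 0) :
    ∃ p : V × Dual K V, p ≠ 0 ∧
      ι K p.1 * (algebraMap K _ 0 + ω + η) + p.2 ⌟ (algebraMap K _ 0 + ω + η) = 0 := by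
  obtain ⟨f, hf0, hf⟩ := exists_ne_zero_contractLeft_eq_zero hV hη
  obtain ⟨a, ha⟩ := exists_contractLeft_eq_ι_of_mem_exteriorPower_two hω f
  by_cases ha0 : a = 0
  · refine ⟨(0, f), fun h ↦ hf0 (congrArg Prod.snd h),
      ι_mul_add_contractLeft_eq_zero ?_ ?_ ?_⟩ <;> simp [ha, ha0, hf]
  · refine ⟨(a, 0), fun h ↦ ha0 (congrArg Prod.fst h),
      ι_mul_add_contractLeft_eq_zero ?_ ?_ ?_⟩
    · simp
    · have h := contractLeft_sq_of_mem_exteriorPower_two hω f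
      rw [hsq, map_zero, ha] at h
      rw [(smul_eq_zero_iff_right two_ne_zero).1 h.symm, map_zero, LinearMap.zero_apply, add_zero]
    · rw [← ha, contractLeft_mul_eq_neg (by omega) hω hη, hf, mul_zero, neg_zero]

lemma exists_ker_of_sq_ne_zero [CharZero K] (hV : finrank K V = 5)
    {ω η : ExteriorAlgebra K V} (hω : ω ∈ ⋀[K]^2 V) (hη : η ∈ ⋀[K]^4 V) (hsq : ω * ω ≠ 0) :
    ∃ p : V × Dual K V, p ≠ 0 ∧
      ι K p.1 * (algebraMap K _ 0 + ω + η) + p.2 ⌟ (algebraMap K _ 0 + ω + η) = 0 := by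
  obtain ⟨vol, -, hsurj⟩ := exists_forall_mem_exteriorPower_eq_contractLeft hV
  obtain ⟨h, rfl⟩ := hsurj η hη
  obtain ⟨f, hf⟩ := hsurj _ (mul_mem_exteriorPower hω hω)
  obtain ⟨a, ha⟩ := exists_contractLeft_eq_ι_of_mem_exteriorPower_two hω f
  obtain ⟨b, hb⟩ := exists_contractLeft_eq_ι_of_mem_exteriorPower_two hω h
  have haω : ι K a * ω = 0 := by
    have hf2 := contractLeft_sq_of_mem_exteriorPower_two hω f
    rw [hf, CliffordAlgebra.contractLeft_contractLeft, ha] at hf2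
    exact (smul_eq_zero_iff_right two_ne_zero).1 hf2.symm
  have ha0 : a = 0 := by
    refine (forall_dual_apply_eq_zero_iff K a).1 fun k ↦ ?_
    obtain ⟨d, hd⟩ := exists_contractLeft_eq_ι_of_mem_exteriorPower_two hω k
    have hk := contractLeft_ι_mul' k a ω
    rw [haω, map_zero, hd, eq_comm, sub_eq_zero] at hk
    have hkω : k a • (ω * ω) = 0 := by
      rw [← smul_mul_assoc, hk, mul_assoc, ← mul_ι_of_mem_exteriorPower_two hω, ← mul_assoc, haω,
        zero_mul]
    exact (smul_eq_zero.1 hkω).resolve_right hsq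
  refine ⟨((2 : K) • b, f), fun h0 ↦ hsq ?_, ι_mul_add_contractLeft_eq_zero ?_ ?_ ?_⟩
  · rw [hf, (Prod.mk_eq_zero.1 h0).2, map_zero, LinearMap.zero_apply]
  · rw [zero_smul, zero_add, ha, ha0, map_zero]
  · rw [CliffordAlgebra.contractLeft_comm, ← hf, contractLeft_sq_of_mem_exteriorPower_two hω, hb,
      map_smul, smul_mul_assoc, add_neg_cancel]
  · rw [map_smul, smul_mul_assoc, ← hb, contractLeft_mul_eq_neg (by omega) hω hη,
      CliffordAlgebra.contractLeft_contractLeft, mul_zero, neg_zero, smul_zero]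

lemma exists_ker_of_mem_even [CharZero K] (hV : finrank K V = 5) {δ : ExteriorAlgebra K V}
    (hδ : δ ∈ ⋀[K]^0 V ⊔ ⋀[K]^2 V ⊔ ⋀[K]^4 V) :
    ∃ p : V × Dual K V, p ≠ 0 ∧ ι K p.1 * δ + p.2 ⌟ δ = 0 := by
  obtain ⟨x, hx, η, hη, rfl⟩ := Submodule.mem_sup.1 hδ
  obtain ⟨y, hy, ω, hω, rfl⟩ := Submodule.mem_sup.1 hx
  rw [exteriorPower, pow_zero] at hy
  obtain ⟨c, rfl⟩ := Submodule.mem_one.1 hy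
  by_cases hc : c = 0
  · subst hc
    by_cases hsq : ω * ω = 0
    · exact exists_ker_of_sq_eq_zero hV hω hη hsq
    · exact exists_ker_of_sq_ne_zero hV hω hη hsq
  · exact exists_ker_of_scalar_ne_zero hV hc hω hη

end Field

/-- For `dim E = 5` and every `δ ∈ Δ₊ = ⋀⁰E ⊕ ⋀²E ⊕ ⋀⁴E`, the map
`ψ_δ : E ⊕ E* → Δ₋`, `(e,f) ↦ e ∧ δ + f ⌟ δ`, has a nontrivial kernel; equivalently,
`rank ψ_δ ≤ 9`. -/
theorem psi_ker_nontrivial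
    [FiniteDimensional ℂ E] (hE : finrank ℂ E = 5)
    (δ : ExteriorAlgebra ℂ E) (hδ : δ ∈ ⋀[ℂ]^0 E ⊔ ⋀[ℂ]^2 E ⊔ ⋀[ℂ]^4 E) :
    (∃ p : E × Module.Dual ℂ E, p ≠ 0 ∧
        ι ℂ p.1 * δ + CliffordAlgebra.contractLeft (Q := (0 : QuadraticForm ℂ E)) p.2 δ = 0) ∧
      finrank ℂ (LinearMap.range (psi δ)) ≤ 9 := by
  obtain ⟨p, hp0, hp⟩ := exists_ker_of_mem_even hE hδ
  refine ⟨⟨p, hp0, hp⟩, ?_⟩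
  have hker : 0 < finrank ℂ (LinearMap.ker (psi δ)) := by
    rw [Nat.pos_iff_ne_zero, Ne, Submodule.finrank_eq_zero]
    exact (Submodule.ne_bot_iff _).2 ⟨p, hp, hp0⟩
  have hrank := LinearMap.finrank_range_add_finrank_ker (psi δ)
  rw [finrank_prod, Subspace.dual_finrank_eq, hE] at hrank
  omega
end

section
/- Let A = ℂ⁷. For an endomorphism X of A, let D³(X) : ⋀³A → ⋀³A be the derivation action, i.e. the linear map induced by the alternating trilinear map (a,b,c) ↦ (Xa)∧b∧c + a∧(Xb)∧c + a∧b∧(Xc). Then for every ω ∈ ⋀³A, the linear map 𝔰𝔩(A) → ⋀³A, X ↦ D³(X)(ω), defined on the space of traceless endomorphisms of A, is not surjective; equivalently its rank is at most 34 = dim ⋀³ℂ⁷ − 1. -/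
open Module LinearMap ExteriorAlgebra

namespace ExteriorAlgebra

variable {R M : Type*} [CommRing R] [AddCommGroup M] [Module R M]

/-- The algebra map `x ↦ x + ε d(x)`, where `d` is the derivation extending `f`. -/
noncomputable def liftDual (f : Module.End R M) :
    ExteriorAlgebra R M →ₐ[R] TrivSqZeroExt (ExteriorAlgebra R M) (ExteriorAlgebra R M) :=
  lift R ⟨(TrivSqZeroExt.inlAlgHom R _ _).toLinearMap ∘ₗ ι R +
      (TrivSqZeroExt.inrHom _ _).restrictScalars R ∘ₗ ι R ∘ₗ f, fun m => by
    ext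
    · simp
    · simp⟩

/-- The derivation of the exterior algebra extending an endomorphism of the module. -/
noncomputable def endDerivation (f : Module.End R M) :
    ExteriorAlgebra R M →ₗ[R] ExteriorAlgebra R M :=
  (TrivSqZeroExt.sndHom (ExteriorAlgebra R M) (ExteriorAlgebra R M)).restrictScalars R ∘ₗ
    (liftDual f).toLinearMap

theorem fst_liftDual (f : Module.End R M) (x : ExteriorAlgebra R M) :
    (liftDual f x).fst = x := by
  have : (TrivSqZeroExt.fstHom R _ _).comp (liftDual f) = AlgHom.id R (ExteriorAlgebra R M) := by
    ext m
    simp [liftDual]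
  exact DFunLike.congr_fun this x

@[simp]
theorem endDerivation_ι (f : Module.End R M) (m : M) :
    endDerivation f (ι R m) = ι R (f m) := by
  simp [endDerivation, liftDual]

theorem endDerivation_mul (f : Module.End R M) (x y : ExteriorAlgebra R M) :
    endDerivation f (x * y) = x * endDerivation f y + endDerivation f x * y := by
  simp [endDerivation, fst_liftDual]

@[simp]
theorem endDerivation_algebraMap (f : Module.End R M) (r : R) :
    endDerivation f (algebraMap R _ r) = 0 := by
  simp [endDerivation, TrivSqZeroExt.algebraMap_eq_inl']

theorem endDerivation_ιMulti (f : Module.End R M) {n : ℕ} (v : Fin n → M) :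
    endDerivation f (ιMulti R n v) = ∑ i, ιMulti R n (Function.update v i (f (v i))) := by
  induction n with
  | zero => simpa using endDerivation_algebraMap (M := M) f (1 : R)
  | succ n ih =>
    simp only [ιMulti_succ_apply, Fin.sum_univ_succ, endDerivation_mul, ih, endDerivation_ι,
      Finset.mul_sum]
    rw [add_comm]
    congr 1
    refine Finset.sum_congr rfl fun i _ => ?_
    congr 2
    ext j
    simp [Matrix.vecTail, Function.update_apply]

theorem endDerivation_contractLeft (f : Module.End R M) (u : Dual R M)
    (x : ExteriorAlgebra R M) :
    endDerivation f (CliffordAlgebra.contractLeft (Q := 0) u x) =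
      CliffordAlgebra.contractLeft (Q := 0) u (endDerivation f x) -
        CliffordAlgebra.contractLeft (Q := 0) (u ∘ₗ f) x := by
  induction x using CliffordAlgebra.left_induction with
  | algebraMap r => simp [endDerivation_algebraMap (M := M) f r]
  | add x y hx hy => simp only [map_add, hx, hy]; abel
  | ι_mul x m hx =>
    change endDerivation f (CliffordAlgebra.contractLeft u (ι R m * x)) =
      CliffordAlgebra.contractLeft u (endDerivation f (ι R m * x)) -
        CliffordAlgebra.contractLeft (u ∘ₗ f) (ι R m * x)
    simp only [endDerivation_mul, endDerivation_ι, map_add, map_sub, map_smul, hx,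
      CliffordAlgebra.contractLeft_ι_mul, comp_apply, mul_sub]
    abel


section Basis

variable {n : ℕ} (b : Basis (Fin n) R M)

/-- The top coefficient of an element of the exterior algebra with respect to a basis. -/
noncomputable def topCoeff : ExteriorAlgebra R M →ₗ[R] R :=
  liftAlternating fun k => if h : n = k then h ▸ b.det else 0

theorem topCoeff_ιMulti (v : Fin n → M) : topCoeff b (ιMulti R n v) = b.det v := by
  simp [topCoeff]

theorem topCoeff_ιMulti_of_ne {k : ℕ} (h : n ≠ k) (v : Fin k → M) :
    topCoeff b (ιMulti R k v) = 0 := by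
  simp [topCoeff, h]

theorem det_update_basis (i : Fin n) (w : M) :
    b.det (Function.update b i w) = b.repr w i := by
  conv_lhs => rw [← b.sum_repr w]
  rw [AlternatingMap.map_update_sum, Finset.sum_eq_single i]
  · simp [AlternatingMap.map_update_smul, Basis.det_self]
  · intro j _ hj
    rw [AlternatingMap.map_update_smul, AlternatingMap.map_update_self _ _ hj.symm, smul_zero]
  · simp

theorem topCoeff_endDerivation (f : Module.End R M) (x : ExteriorAlgebra R M) :
    topCoeff b (endDerivation f x) = LinearMap.trace R M f * topCoeff b x := by
  suffices h : topCoeff b ∘ₗ endDerivation f = LinearMap.trace R M f • topCoeff b from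
    LinearMap.congr_fun h x
  refine lhom_ext fun k => ?_
  by_cases hk : n = k
  · subst hk
    rw [AlternatingMap.eq_smul_basis_det b (compAlternatingMap _ _)]
    have ht : LinearMap.trace R M f = ∑ i, b.repr (f (b i)) i := by
      rw [LinearMap.trace_eq_matrix_trace R b]
      simp [Matrix.trace, LinearMap.toMatrix_apply]
    ext v
    simp [endDerivation_ιMulti, topCoeff_ιMulti, det_update_basis, ht]
  · ext v
    simp [endDerivation_ιMulti, topCoeff_ιMulti_of_ne b hk]

/-- The matrix of the trilinear expression `(u, v) ↦ u⌟x ∧ v⌟x ∧ x`, read off in top degree. -/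
noncomputable def contractionMatrix (x : ExteriorAlgebra R M) : Matrix (Fin n) (Fin n) R :=
  Matrix.of fun i j => topCoeff b
    (CliffordAlgebra.contractLeft (Q := 0) (b.coord i) x *
      CliffordAlgebra.contractLeft (Q := 0) (b.coord j) x * x)

theorem coord_comp (f : Module.End R M) (i : Fin n) :
    b.coord i ∘ₗ f = ∑ k, LinearMap.toMatrix b b f i k • b.coord k := by
  refine b.ext fun j => ?_
  simp [LinearMap.toMatrix_apply, Finsupp.single_apply]

theorem trace_smul_contractionMatrix (f : Module.End R M) {x : ExteriorAlgebra R M}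
    (hx : endDerivation f x = 0) :
    LinearMap.trace R M f • contractionMatrix b x =
      -(LinearMap.toMatrix b b f * contractionMatrix b x +
        contractionMatrix b x * (LinearMap.toMatrix b b f).transpose) := by
  ext i j
  have h := topCoeff_endDerivation b f
    (CliffordAlgebra.contractLeft (Q := 0) (b.coord i) x *
      CliffordAlgebra.contractLeft (Q := 0) (b.coord j) x * x)
  simp only [endDerivation_mul, endDerivation_contractLeft, hx, coord_comp] at h
  simp only [Matrix.smul_apply, Matrix.neg_apply, Matrix.add_apply, Matrix.mul_apply,
    contractionMatrix, Matrix.of_apply, Matrix.transpose_apply, smul_eq_mul, ← h]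
  simp only [map_sum, map_smul, map_zero, map_add, LinearMap.sum_apply, LinearMap.smul_apply,
    Finset.sum_mul, Finset.mul_sum, zero_sub, mul_neg, neg_mul, map_neg, mul_zero, zero_add,
    add_mul, smul_mul_assoc, mul_smul_comm, smul_eq_mul, neg_add]
  rw [add_comm]
  simp only [mul_comm]

/-- An endomorphism of nonzero trace cannot annihilate an element whose contraction matrix is
nondegenerate. -/
theorem trace_eq_zero_of_endDerivation_eq_zero {K V : Type*} [Field K] [CharZero K]
    [AddCommGroup V] [Module K V] (b : Basis (Fin n) K V) (f : Module.End K V)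
    {x : ExteriorAlgebra K V} (hx : endDerivation f x = 0)
    (hdet : (contractionMatrix b x).det ≠ 0) : LinearMap.trace K V f = 0 := by
  have hu : IsUnit (contractionMatrix b x).det := hdet.isUnit
  have h := congrArg (fun A => (A * (contractionMatrix b x)⁻¹).trace)
    (trace_smul_contractionMatrix b f hx)
  simp only [Matrix.smul_mul, Matrix.neg_mul, Matrix.add_mul, Matrix.trace_smul, Matrix.trace_neg,
    Matrix.trace_add, Matrix.mul_nonsing_inv_cancel_right _ _ hu, Matrix.mul_nonsing_inv _ hu] at h
  rw [Matrix.trace_mul_comm, Matrix.nonsing_inv_mul_cancel_left _ _ hu, Matrix.trace_transpose,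
    ← LinearMap.trace_eq_matrix_trace, Matrix.trace_one, Fintype.card_fin, smul_eq_mul] at h
  have : LinearMap.trace K V f * (n + 2 : K) = 0 := by linear_combination h
  exact (mul_eq_zero.mp this).resolve_right (by exact_mod_cast (by omega : n + 2 ≠ 0))

set_option maxHeartbeats 4000000 in
/-- The matrix of products `c i * c j * w`, for the contractions `c i` of the trivector
`w = e₀₁₄ + e₀₂₅ + e₀₃₆ + e₁₂₃ + e₄₅₆` in anticommuting square-zero variables. -/
theorem matrix_split_contractions {E : Type*} [Ring E] [Algebra R E] (e : Fin 7 → E)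
    (hsq : ∀ i, e i * e i = 0) (hsw : ∀ i j, e i * e j = -(e j * e i)) (τ : E →ₗ[R] R)
    (htop : τ (e 0 * (e 1 * (e 2 * (e 3 * (e 4 * (e 5 * e 6)))))) = 1) :
    let c : Fin 7 → E := ![e 1 * e 4 + e 2 * e 5 + e 3 * e 6, e 2 * e 3 - e 0 * e 4, -(e 0 * e 5) - e 1 * e 3,
      e 1 * e 2 - e 0 * e 6, e 0 * e 1 + e 5 * e 6, e 0 * e 2 - e 4 * e 6,
      e 0 * e 3 + e 4 * e 5]
    let w : E := e 0 * (e 1 * e 4) + e 0 * (e 2 * e 5) + e 0 * (e 3 * e 6) + e 1 * (e 2 * e 3) +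
        e 4 * (e 5 * e 6)
    Matrix.of (fun i j => τ (c i * (c j * w))) =
      !![-6, 0, 0, 0, 0, 0, 0;
        0, 0, 0, 0, 3, 0, 0;
        0, 0, 0, 0, 0, 3, 0;
        0, 0, 0, 0, 0, 0, 3;
        0, 3, 0, 0, 0, 0, 0;
        0, 0, 3, 0, 0, 0, 0;
        0, 0, 0, 3, 0, 0, 0] := by
  have hsq' (i : Fin 7) (x : E) : e i * (e i * x) = 0 := by
    rw [← mul_assoc, hsq, zero_mul]
  have hsw' (i j : Fin 7) (x : E) (_ : j < i) : e i * (e j * x) = -(e j * (e i * x)) := by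
    rw [← mul_assoc, hsw i j, neg_mul, mul_assoc]
  replace hsw (i j : Fin 7) (_ : j < i) := hsw i j
  intro c w
  have hη (j : Fin 7) : c j * w =
      ![(-2 : R) • (e 0 * (e 1 * (e 2 * (e 4 * e 5))) + e 0 * (e 1 * (e 3 * (e 4 * e 6))) +
          e 0 * (e 2 * (e 3 * (e 5 * e 6)))),
        (2 : R) • (e 0 * (e 1 * (e 2 * (e 3 * e 4)))) + e 2 * (e 3 * (e 4 * (e 5 * e 6))),
        (2 : R) • (e 0 * (e 1 * (e 2 * (e 3 * e 5)))) - e 1 * (e 3 * (e 4 * (e 5 * e 6))),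
        (2 : R) • (e 0 * (e 1 * (e 2 * (e 3 * e 6)))) + e 1 * (e 2 * (e 4 * (e 5 * e 6))),
        (2 : R) • (e 0 * (e 1 * (e 4 * (e 5 * e 6)))) + e 1 * (e 2 * (e 3 * (e 5 * e 6))),
        (2 : R) • (e 0 * (e 2 * (e 4 * (e 5 * e 6)))) - e 1 * (e 2 * (e 3 * (e 4 * e 6))),
        (2 : R) • (e 0 * (e 3 * (e 4 * (e 5 * e 6)))) + e 1 * (e 2 * (e 3 * (e 4 * e 5)))] j := by
    fin_cases j <;>
    · simp [c, w, mul_add, add_mul, sub_mul, mul_assoc, hsq, hsq', hsw, hsw', -mul_eq_zero]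
      module
  simp only [hη]
  ext i j
  fin_cases i <;> fin_cases j <;>
  · simp [c, mul_add, add_mul, mul_sub, sub_mul, mul_assoc, hsq, hsq', hsw, hsw', htop]
    try norm_num

/-- A trivector in dimension seven whose stabilizer is of type `G₂`. -/
noncomputable def splitTrivector (b : Basis (Fin 7) R M) : ⋀[R]^3 M :=
  exteriorPower.ιMulti R 3 ![b 0, b 1, b 4] + exteriorPower.ιMulti R 3 ![b 0, b 2, b 5] +
    exteriorPower.ιMulti R 3 ![b 0, b 3, b 6] + exteriorPower.ιMulti R 3 ![b 1, b 2, b 3] +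
      exteriorPower.ιMulti R 3 ![b 4, b 5, b 6]

theorem contractionMatrix_splitTrivector (b : Basis (Fin 7) R M) :
    contractionMatrix b (splitTrivector b : ExteriorAlgebra R M) =
      !![-6, 0, 0, 0, 0, 0, 0;
        0, 0, 0, 0, 3, 0, 0;
        0, 0, 0, 0, 0, 3, 0;
        0, 0, 0, 0, 0, 0, 3;
        0, 3, 0, 0, 0, 0, 0;
        0, 0, 3, 0, 0, 0, 0;
        0, 0, 0, 3, 0, 0, 0] := by
  have hw : (splitTrivector b : ExteriorAlgebra R M) =
      ι R (b 0) * (ι R (b 1) * ι R (b 4)) + ι R (b 0) * (ι R (b 2) * ι R (b 5)) +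
        ι R (b 0) * (ι R (b 3) * ι R (b 6)) + ι R (b 1) * (ι R (b 2) * ι R (b 3)) +
          ι R (b 4) * (ι R (b 5) * ι R (b 6)) := by
    simp [splitTrivector, ιMulti_apply]
  have hc (i : Fin 7) : CliffordAlgebra.contractLeft (Q := 0) (b.coord i)
      (splitTrivector b : ExteriorAlgebra R M) =
        ![ι R (b 1) * ι R (b 4) + ι R (b 2) * ι R (b 5) + ι R (b 3) * ι R (b 6),
          ι R (b 2) * ι R (b 3) - ι R (b 0) * ι R (b 4),
          -(ι R (b 0) * ι R (b 5)) - ι R (b 1) * ι R (b 3),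
          ι R (b 1) * ι R (b 2) - ι R (b 0) * ι R (b 6),
          ι R (b 0) * ι R (b 1) + ι R (b 5) * ι R (b 6),
          ι R (b 0) * ι R (b 2) - ι R (b 4) * ι R (b 6),
          ι R (b 0) * ι R (b 3) + ι R (b 4) * ι R (b 5)] i := by
    rw [hw]
    simp only [map_add, CliffordAlgebra.contractLeft_ι_mul, CliffordAlgebra.contractLeft_ι,
      Basis.coord_apply, Basis.repr_self]
    fin_cases i <;> simp <;> abel
  have htop : topCoeff b (ι R (b 0) * (ι R (b 1) * (ι R (b 2) * (ι R (b 3) * (ι R (b 4) *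
      (ι R (b 5) * ι R (b 6))))))) = 1 := by
    have h := topCoeff_ιMulti b b
    rw [Basis.det_self] at h
    simpa [ιMulti_apply, Matrix.vecTail] using h
  simp only [contractionMatrix, mul_assoc, hc]
  rw [hw]
  exact matrix_split_contractions _ (fun i => ι_sq_zero _)
    (fun i j => eq_neg_of_add_eq_zero_left (ι_add_mul_swap _ _)) _ htop

theorem det_contractionMatrix_splitTrivector (b : Basis (Fin 7) R M) :
    (contractionMatrix b (splitTrivector b : ExteriorAlgebra R M)).det = 4374 := by
  rw [contractionMatrix_splitTrivector]
  simp [Matrix.det_succ_row_zero, Fin.sum_univ_succ, Fin.succAbove]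
  norm_num

end Basis

end ExteriorAlgebra

section DerivationAction

variable {A : Type*} [AddCommGroup A] [Module ℂ A]

theorem coe_apply_eq_endDerivation
    (D : Module.End ℂ A →ₗ[ℂ] (⋀[ℂ]^3 A →ₗ[ℂ] ⋀[ℂ]^3 A))
    (hD : ∀ (X : Module.End ℂ A) (x : ⋀[ℂ]^3 A) (a b c : A),
      (x : ExteriorAlgebra ℂ A) = ιMulti ℂ 3 ![a, b, c] →
        (D X x : ExteriorAlgebra ℂ A) =
          ιMulti ℂ 3 ![X a, b, c] + ιMulti ℂ 3 ![a, X b, c] + ιMulti ℂ 3 ![a, b, X c])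
    (X : Module.End ℂ A) (x : ⋀[ℂ]^3 A) :
    (D X x : ExteriorAlgebra ℂ A) = endDerivation X x := by
  suffices h : (⋀[ℂ]^3 A).subtype ∘ₗ D X = endDerivation X ∘ₗ (⋀[ℂ]^3 A).subtype from
    LinearMap.congr_fun h x
  refine exteriorPower.linearMap_ext ?_
  ext v
  obtain ⟨a, b, c, rfl⟩ : ∃ a b c, v = ![a, b, c] :=
    ⟨v 0, v 1, v 2, by ext i; fin_cases i <;> rfl⟩
  change (D X (exteriorPower.ιMulti ℂ 3 ![a, b, c]) : ExteriorAlgebra ℂ A) =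
    endDerivation X (ιMulti ℂ 3 ![a, b, c])
  rw [hD X (exteriorPower.ιMulti ℂ 3 ![a, b, c]) a b c rfl, endDerivation_ιMulti,
    Fin.sum_univ_three]
  congr! 2
  all_goals ext i; fin_cases i <;> rfl

theorem continuous_contractionMatrix_add_smul {n : ℕ} (b : Basis (Fin n) ℂ A)
    (x y : ExteriorAlgebra ℂ A) : Continuous fun s : ℂ => contractionMatrix b (x + s • y) := by
  refine continuous_matrix fun i j => ?_
  simp only [contractionMatrix, Matrix.of_apply, map_add, map_smul, mul_add, add_mul,
    smul_mul_assoc, mul_smul_comm, smul_add, smul_eq_mul]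
  fun_prop

/-- A pencil `g + s • f` of linear maps with `f` surjective has only finitely many
non-surjective members. -/
theorem finite_not_surjective_add_smul {K V W : Type*} [Field K] [AddCommGroup V] [Module K V]
    [AddCommGroup W] [Module K W] [FiniteDimensional K W] (f g : V →ₗ[K] W)
    (hf : Function.Surjective f) :
    {s : K | ¬ Function.Surjective (g + s • f)}.Finite := by
  obtain ⟨r, hr⟩ := f.exists_rightInverse_of_surjective (LinearMap.range_eq_top.mpr hf)
  refine (Module.End.finite_spectrum (-(g ∘ₗ r))).subset fun s hs => ?_
  by_contra h
  rw [spectrum.notMem_iff, Module.End.isUnit_iff] at h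
  refine hs fun y => ?_
  obtain ⟨x, hx⟩ := h.2 y
  refine ⟨r x, ?_⟩
  have hfr : f (r x) = x := LinearMap.congr_fun hr x
  rw [← hx]
  simp [hfr, add_comm]

end DerivationAction

/-- Let `A = ℂ⁷` and let `D³(X) : ⋀³A → ⋀³A` be the derivation action of an endomorphism `X`,
i.e. the linear map with `D³(X)(a∧b∧c) = (Xa)∧b∧c + a∧(Xb)∧c + a∧b∧(Xc)`. Then for every
`ω ∈ ⋀³A`, the linear map `𝔰𝔩(A) → ⋀³A`, `X ↦ D³(X)(ω)`, on traceless endomorphisms, is not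
surjective; equivalently its rank is at most `34 = dim ⋀³ℂ⁷ − 1`. -/
theorem derivation_action_not_surjective_dim_seven
    {A : Type*} [AddCommGroup A] [Module ℂ A] [FiniteDimensional ℂ A]
    (hA : finrank ℂ A = 7)
    (D : Module.End ℂ A →ₗ[ℂ] (⋀[ℂ]^3 A →ₗ[ℂ] ⋀[ℂ]^3 A))
    (hD : ∀ (X : Module.End ℂ A) (x : ⋀[ℂ]^3 A) (a b c : A),
      (x : ExteriorAlgebra ℂ A) = ιMulti ℂ 3 ![a, b, c] →
        (D X x : ExteriorAlgebra ℂ A) =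
          ιMulti ℂ 3 ![X a, b, c] + ιMulti ℂ 3 ![a, X b, c] + ιMulti ℂ 3 ![a, b, X c])
    (ω : ⋀[ℂ]^3 A) :
    ¬ Function.Surjective
        ((D.flip ω).domRestrict (LinearMap.ker (LinearMap.trace ℂ A))) ∧
      finrank ℂ (LinearMap.range
        ((D.flip ω).domRestrict (LinearMap.ker (LinearMap.trace ℂ A)))) ≤ 34 := by
  have hns : ¬ Function.Surjective
      ((D.flip ω).domRestrict (LinearMap.ker (LinearMap.trace ℂ A))) := by
    intro hsurj
    let b : Basis (Fin 7) ℂ A := finBasisOfFinrankEq ℂ A hA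
    let ω₀ := splitTrivector b
    have hdet : ∀ᶠ s : ℂ in nhdsWithin 0 {0}ᶜ,
        (contractionMatrix b ((ω₀ + s • ω : ⋀[ℂ]^3 A) : ExteriorAlgebra ℂ A)).det ≠ 0 := by
      refine Filter.Eventually.filter_mono nhdsWithin_le_nhds ?_
      refine ((continuous_contractionMatrix_add_smul b
        (ω₀ : ExteriorAlgebra ℂ A) ω).matrix_det.continuousAt).eventually_ne ?_
      simp [ω₀, det_contractionMatrix_splitTrivector]
    have hfin := finite_not_surjective_add_smul _
      ((D.flip ω₀).domRestrict (LinearMap.ker (LinearMap.trace ℂ A))) hsurj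
    have hs' := nhdsNE_le_cofinite (0 : ℂ) hfin.eventually_cofinite_notMem
    obtain ⟨s, hs, hsurj'⟩ := (hdet.and hs').exists
    obtain ⟨⟨X, hX⟩, hXω⟩ := not_not.mp hsurj' (ω₀ + s • ω)
    have hid : D LinearMap.id (ω₀ + s • ω) = (3 : ℂ) • (ω₀ + s • ω) := by
      suffices h : D LinearMap.id = (3 : ℂ) • LinearMap.id by rw [h]; rfl
      refine exteriorPower.linearMap_ext ?_
      ext v
      change (D LinearMap.id (exteriorPower.ιMulti ℂ 3 v) : ExteriorAlgebra ℂ A) =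
        (3 : ℂ) • ιMulti ℂ 3 v
      rw [coe_apply_eq_endDerivation D hD, exteriorPower.ιMulti_apply_coe, endDerivation_ιMulti]
      simp only [LinearMap.id_apply, Function.update_eq_self, Finset.sum_const, Finset.card_univ,
        Fintype.card_fin, ← Nat.cast_smul_eq_nsmul ℂ, Nat.cast_ofNat]
    have hY : endDerivation (X - (3 : ℂ)⁻¹ • LinearMap.id)
        ((ω₀ + s • ω : ⋀[ℂ]^3 A) : ExteriorAlgebra ℂ A) = 0 := by
      rw [← coe_apply_eq_endDerivation D hD, map_sub, map_smul, LinearMap.sub_apply,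
        LinearMap.smul_apply, hid, smul_smul]
      have : D X (ω₀ + s • ω) = ω₀ + s • ω := by simpa using hXω
      simp [this]
    have htr := trace_eq_zero_of_endDerivation_eq_zero b _ hY hs
    rw [map_sub, LinearMap.mem_ker.mp hX, map_smul, LinearMap.trace_id, hA] at htr
    norm_num at htr
  refine ⟨hns, ?_⟩
  have h35 : finrank ℂ (⋀[ℂ]^3 A) = 35 := by
    rw [exteriorPower.finrank_eq, hA]
    rfl
  have := Submodule.finrank_lt (mt LinearMap.range_eq_top.mp hns)
  omega
end

section
/- Let A = ℂ⁸. For an endomorphism X of A, let D³(X) : ⋀³A → ⋀³A be the derivation action, i.e. the linear map induced by the alternating trilinear map (a,b,c) ↦ (Xa)∧b∧c + a∧(Xb)∧c + a∧b∧(Xc). Then for every ω ∈ ⋀³A, the linear map 𝔰𝔩(A) → ⋀³A, X ↦ D³(X)(ω), defined on the space of traceless endomorphisms of A, is not surjective; equivalently its rank is at most 55 = dim ⋀³ℂ⁸ − 1. -/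
open Module LinearMap ExteriorAlgebra

/-- Multilinear maps between finite-dimensional coordinate spaces are continuous. -/
theorem MultilinearMap.continuous_of_pi {n m : ℕ} {k : ℕ}
    (f : MultilinearMap ℂ (fun _ : Fin k => Fin m → ℂ) (Fin n → ℂ)) : Continuous f := by
  have h : ∀ v : Fin k → Fin m → ℂ,
      f v = ∑ r : Fin k → Fin m, (∏ i, v i (r i)) • f (fun i => Pi.single (r i) 1) := by
    intro v
    have hv : v = fun i => ∑ j, v i j • (Pi.single j 1 : Fin m → ℂ) := by
      funext i
      exact pi_eq_sum_univ' (v i)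
    conv_lhs => rw [hv]
    rw [f.map_sum]
    simp only [f.map_smul_univ]
  rw [show (f : (Fin k → Fin m → ℂ) → Fin n → ℂ) = _ from funext h]
  fun_prop

section
variable {A : Type*} [AddCommGroup A] [Module ℂ A] {k : ℕ}

/-- `D X` is the derivation of `⋀ᵏA` extending the endomorphism `X` of `A`. -/
def IsDerivationAction (D : Module.End ℂ A →ₗ[ℂ] (⋀[ℂ]^k A →ₗ[ℂ] ⋀[ℂ]^k A)) : Prop :=
  ∀ (X : Module.End ℂ A) (a : Fin k → A), D X (exteriorPower.ιMulti ℂ k a) =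
    ∑ i, exteriorPower.ιMulti ℂ k (Function.update a i (X (a i)))

variable {D : Module.End ℂ A →ₗ[ℂ] (⋀[ℂ]^k A →ₗ[ℂ] ⋀[ℂ]^k A)}

/-- The action map `g ↦ ⋀ᵏg(ω)`, read in coordinates, has derivative `X ↦ D X ω` at the
identity. -/
theorem IsDerivationAction.hasStrictFDerivAt (hD : IsDerivationAction D) {m n : ℕ}
    (e : (Fin m → ℂ) →ₗ[ℂ] Module.End ℂ A) (L : ⋀[ℂ]^k A →ₗ[ℂ] (Fin n → ℂ))
    {x₀ : Fin m → ℂ} (hx₀ : e x₀ = LinearMap.id) (ω : ⋀[ℂ]^k A) :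
    HasStrictFDerivAt (fun x => L (exteriorPower.map k (e x) ω))
      (LinearMap.toContinuousLinearMap (L ∘ₗ D.flip ω ∘ₗ e)) x₀ := by
  have hω : ω ∈ Submodule.span ℂ (Set.range (exteriorPower.ιMulti ℂ k (M := A))) := by
    simp [exteriorPower.ιMulti_span]
  induction hω using Submodule.span_induction with
  | mem y hy =>
    obtain ⟨a, rfl⟩ := hy
    let f : MultilinearMap ℂ (fun _ : Fin k => Fin m → ℂ) (Fin n → ℂ) :=
      (L.compMultilinearMap (exteriorPower.ιMulti ℂ k (M := A)).toMultilinearMap).compLinearMap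
        (fun i => (LinearMap.applyₗ (a i)) ∘ₗ e)
    let F : ContinuousMultilinearMap ℂ (fun _ : Fin k => Fin m → ℂ) (Fin n → ℂ) :=
      ⟨f, f.continuous_of_pi⟩
    let d : (Fin m → ℂ) →L[ℂ] (Fin k → Fin m → ℂ) :=
      ContinuousLinearMap.pi fun _ => ContinuousLinearMap.id ℂ _
    have h := (F.hasStrictFDerivAt (d x₀)).comp x₀ d.hasStrictFDerivAt
    have hF : ∀ v, F v = L (exteriorPower.ιMulti ℂ k fun i => e (v i) (a i)) := fun _ => rfl
    convert! h using 1
    · funext x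
      simp [hF, d, Function.comp_def]
    · ext1 x
      have hx : D (e x) (exteriorPower.ιMulti ℂ k a) = _ := hD (e x) a
      simp only [coe_toContinuousLinearMap', LinearMap.comp_apply, flip_apply, hx, map_sum,
        ContinuousLinearMap.comp_apply, ContinuousMultilinearMap.linearDeriv_apply, hF]
      refine Finset.sum_congr rfl fun i _ => congrArg _ (congrArg _ (funext fun j => ?_))
      rcases eq_or_ne j i with rfl | hj
      · simp [d]
      · simp [hj, d, hx₀]
  | zero =>
    convert! hasStrictFDerivAt_const (𝕜 := ℂ) (0 : Fin n → ℂ) x₀ using 1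
    · funext x
      simp
    · ext x
      simp
  | add y z _ _ hy hz =>
    convert! hy.add hz using 1
    · funext x
      simp
    · ext x
      simp
  | smul c y _ hy =>
    convert! hy.const_smul c using 1
    · funext x
      simp
    · ext x
      simp

theorem IsDerivationAction.comp_map (hD : IsDerivationAction D) (g : A ≃ₗ[ℂ] A)
    (X : Module.End ℂ A) :
    D X ∘ₗ exteriorPower.map k g.toLinearMap =
      exteriorPower.map k g.toLinearMap ∘ₗ D (g.symm.conj X) := by
  refine exteriorPower.linearMap_ext (AlternatingMap.ext fun a => ?_)
  simp only [LinearMap.compAlternatingMap_apply, LinearMap.comp_apply,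
    exteriorPower.map_apply_ιMulti, hD X _, hD (g.symm.conj X) a, map_sum]
  refine Finset.sum_congr rfl fun i _ => ?_
  congr 1
  funext j
  rcases eq_or_ne j i with rfl | hj
  · simp
  · simp [hj]

theorem IsDerivationAction.surjective_of_map (hD : IsDerivationAction D) (g : A ≃ₗ[ℂ] A)
    (ω : ⋀[ℂ]^k A)
    (h : ∀ y, ∃ X, LinearMap.trace ℂ A X = 0 ∧ D X (exteriorPower.map k g.toLinearMap ω) = y)
    (y : ⋀[ℂ]^k A) :
    ∃ X, LinearMap.trace ℂ A X = 0 ∧ D X ω = y := by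
  obtain ⟨X, hX, hy⟩ := h (exteriorPower.map k g.toLinearMap y)
  refine ⟨g.symm.conj X, by simpa using hX, ?_⟩
  have h1 := LinearMap.congr_fun (hD.comp_map g X) ω
  simp only [LinearMap.comp_apply] at h1
  rw [hy] at h1
  exact (exteriorPower.map_injective (n := k) g.symm.toLinearMap (by ext; simp) h1).symm
end

/-- On the line through `ψ` and a surjective `φ`, all but finitely many maps are surjective. -/
theorem finite_not_surjective_lineMap {E V : Type*} [AddCommGroup E] [Module ℂ E]
    [AddCommGroup V] [Module ℂ V] [FiniteDimensional ℂ V] (φ ψ : E →ₗ[ℂ] V)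
    (hφ : Function.Surjective φ) :
    {t : ℂ | ¬ Function.Surjective (ψ + t • (φ - ψ))}.Finite := by
  obtain ⟨s, hs⟩ := φ.exists_rightInverse_of_surjective (LinearMap.range_eq_top.2 hφ)
  set N : Module.End ℂ V := ψ ∘ₗ s with hN
  have hfin := N.finite_hasEigenvalue
  -- `(ψ + t • (φ - ψ)) ∘ s = (1 - t) • N + t • 1`
  refine ((hfin.image fun μ => μ / (μ - 1)).union (Set.finite_singleton 1)).subset ?_
  intro t ht
  by_cases h1 : t = 1
  · exact Or.inr h1
  refine Or.inl ⟨-t / (1 - t), ?_, ?_⟩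
  · by_contra hμ
    apply ht
    have h2 : Function.Injective (N - algebraMap ℂ (Module.End ℂ V) (-t / (1 - t))) := by
      rw [← LinearMap.ker_eq_bot]
      have := hμ
      simp only [Set.mem_ofPred_eq, Module.End.hasEigenvalue_iff, not_not] at this
      rwa [Module.End.eigenspace_def] at this
    have h3 := LinearMap.injective_iff_surjective.1 h2
    intro y
    have ht' : (1 - t) ≠ 0 := sub_ne_zero.2 (Ne.symm h1)
    obtain ⟨z, hz⟩ := h3 ((1 - t)⁻¹ • y)
    refine ⟨s z, ?_⟩
    have h4 : φ (s z) = z := LinearMap.congr_fun hs z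
    have h5 : ψ (s z) = (-t / (1 - t)) • z + (1 - t)⁻¹ • y := by
      rw [← hz]; simp [hN, Module.algebraMap_end_apply]
    simp only [LinearMap.add_apply, LinearMap.smul_apply, LinearMap.sub_apply, h4, h5]
    match_scalars <;> field_simp <;> ring
  · have ht' : (1 - t) ≠ 0 := sub_ne_zero.2 (Ne.symm h1)
    have : -t / (1 - t) - 1 = -1 / (1 - t) := by field_simp; ring
    simp only [this]
    field_simp

/-- If `X ↦ D X ω₀` is surjective, then the `GL(A)`-orbit of `ω₀` meets every line through `ω₀` in
a neighbourhood of `ω₀`. -/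
theorem IsDerivationAction.eventually_exists_map {A : Type*} [AddCommGroup A] [Module ℂ A]
    [FiniteDimensional ℂ A] {k : ℕ} {D : Module.End ℂ A →ₗ[ℂ] (⋀[ℂ]^k A →ₗ[ℂ] ⋀[ℂ]^k A)}
    (hD : IsDerivationAction D) (ω₀ : ⋀[ℂ]^k A) (h : Function.Surjective (D.flip ω₀))
    (η : ⋀[ℂ]^k A) :
    ∀ᶠ t : ℂ in nhds 0, ∃ g : A ≃ₗ[ℂ] A,
      exteriorPower.map k g.toLinearMap ω₀ = ω₀ + t • η := by
  let e := (finBasis ℂ (Module.End ℂ A)).equivFun.symm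
  let L := (finBasis ℂ (⋀[ℂ]^k A)).equivFun
  let b := finBasis ℂ A
  have hx₀ : e (e.symm LinearMap.id) = LinearMap.id := e.apply_symm_apply _
  set x₀ := e.symm LinearMap.id
  have hF := hD.hasStrictFDerivAt e.toLinearMap L.toLinearMap hx₀ ω₀
  have hdet : Continuous fun x => LinearMap.det (e x) := by
    have h1 : Continuous ((LinearMap.toMatrix b b).toLinearMap ∘ₗ e.toLinearMap) :=
      LinearMap.continuous_of_finiteDimensional _
    convert h1.matrix_det using 2 with x
    exact (LinearMap.det_toMatrix b (e x)).symm
  have hunit : ∀ᶠ x in nhds x₀, LinearMap.det (e x) ≠ 0 :=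
    hdet.continuousAt.eventually_ne (by rw [hx₀]; simp)
  have hopen := hF.map_nhds_eq_of_surj (LinearMap.range_eq_top.2 (by
    simpa using L.surjective.comp (h.comp e.surjective)))
  have hev : ∀ᶠ y in nhds (L (exteriorPower.map k (e x₀) ω₀)),
      ∃ x, LinearMap.det (e x) ≠ 0 ∧ L (exteriorPower.map k (e x) ω₀) = y := by
    have h2 := Filter.image_mem_map (m := fun x => L (exteriorPower.map k (e x) ω₀)) hunit
    exact hopen ▸ h2
  have hline : Continuous fun t : ℂ => L (ω₀ + t • η) := by
    simp only [map_add, map_smul]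
    fun_prop
  have h0 := hline.tendsto 0
  rw [show L (ω₀ + (0 : ℂ) • η) = L (exteriorPower.map k (e x₀) ω₀) by simp [hx₀]] at h0
  filter_upwards [h0.eventually hev] with t ht
  obtain ⟨x, hx, hxt⟩ := ht
  exact ⟨LinearEquiv.ofIsUnitDet (v := b) (v' := b) (f := e x)
    (by rw [LinearMap.det_toMatrix]; exact hx.isUnit), L.injective hxt⟩

/-- If the `GL(A)`-orbit of `ω₀` is open and the traceless endomorphisms do not act surjectively at
`ω₀`, then they do not act surjectively at any `ω`. -/
theorem IsDerivationAction.not_surjective {A : Type*} [AddCommGroup A] [Module ℂ A]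
    [FiniteDimensional ℂ A] {k : ℕ} {D : Module.End ℂ A →ₗ[ℂ] (⋀[ℂ]^k A →ₗ[ℂ] ⋀[ℂ]^k A)}
    (hD : IsDerivationAction D) (ω₀ : ⋀[ℂ]^k A) (h : Function.Surjective (D.flip ω₀))
    (h₀ : ¬ Function.Surjective
      ((D.flip ω₀).domRestrict (LinearMap.ker (LinearMap.trace ℂ A)))) (ω : ⋀[ℂ]^k A) :
    ¬ Function.Surjective
      ((D.flip ω).domRestrict (LinearMap.ker (LinearMap.trace ℂ A))) := by
  intro hω
  have hev := hD.eventually_exists_map ω₀ h (ω - ω₀)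
  refine (infinite_of_mem_nhds (0 : ℂ) hev) ((finite_not_surjective_lineMap _
    ((D.flip ω₀).domRestrict (LinearMap.ker (LinearMap.trace ℂ A))) hω).subset ?_)
  rintro t ⟨g, hg⟩ hs
  refine h₀ fun y => ?_
  have hmap : ∀ z, ∃ X, LinearMap.trace ℂ A X = 0 ∧
      D X (exteriorPower.map k g.toLinearMap ω₀) = z := by
    intro z
    obtain ⟨X, hX⟩ := hs z
    refine ⟨X, X.2, ?_⟩
    rw [hg, ← hX]
    simp
  obtain ⟨X, hX, hy⟩ := hD.surjective_of_map g ω₀ hmap y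
  exact ⟨⟨X, hX⟩, hy⟩

/-- An alternating array orthogonal to the `𝔤𝔩₈`-orbit directions at `cartanForm` vanishes: the
equation indexed by `q` and `p` comes from the elementary matrix sending `e_q` to `e_p`. -/
theorem alternating_eq_zero {t : Fin 8 → Fin 8 → Fin 8 → ℂ}
    (h12 : ∀ i j k, t j i k = -t i j k) (h23 : ∀ i j k, t i k j = -t i j k)
    (e0 : ∀ p, t p 2 5 + t p 4 7 = 0) (e1 : ∀ p, t p 3 6 + t p 4 7 = 0)
    (e2 : ∀ p, t 0 p 5 + t p 3 7 = 0) (e3 : ∀ p, t 1 p 6 + t 2 p 7 = 0)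
    (e4 : ∀ p, t 0 p 7 + t 1 p 7 + t p 5 6 = 0) (e5 : ∀ p, t 0 2 p + t 4 p 6 = 0)
    (e6 : ∀ p, t 1 3 p + t 4 5 p = 0) (e7 : ∀ p, t 0 4 p + t 1 4 p + t 2 3 p = 0)
    (i j k : Fin 8) : t i j k = 0 := by
  have hd12 : ∀ i k, t i i k = 0 := fun i k => by linear_combination h12 i i k / 2
  have hd23 : ∀ i k, t k i i = 0 := fun i k => by linear_combination h23 k i i / 2
  have hd13 : ∀ i k, t i k i = 0 := fun i k => by rw [h23, hd12, neg_zero]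
  have s12 : ∀ i j k, j < i → t i j k = -t j i k := fun i j k _ => h12 j i k
  have s23 : ∀ i j k, k < j → t i j k = -t i k j := fun i j k _ => h23 i k j
  have hsorted : ∀ i j k, i < j → j < k → t i j k = 0 := by
    simp only [Fin.forall_fin_succ] at e0 e1 e2 e3 e4 e5 e6 e7
    simp [hd12, hd23, hd13, s12,s23] at e0 e1 e2 e3 e4 e5 e6 e7
    clear h12 h23 hd12 hd23 hd13 s12 s23
    intro i j k hij hjk
    fin_cases i <;> fin_cases j <;> first | (exact absurd hij (by decide)) | skip
    all_goals fin_cases k <;> first | (exact absurd hjk (by decide)) | skip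
    all_goals dsimp only [Fin.reduceFinMk, Fin.zero_eta, Fin.mk_one]
    all_goals grind
  rcases lt_trichotomy i j with h | rfl | h
  · rcases lt_trichotomy j k with h' | rfl | h'
    · exact hsorted i j k h h'
    · exact hd23 j i
    · rw [h23 i k j, neg_eq_zero]
      rcases lt_trichotomy i k with h'' | rfl | h''
      · exact hsorted i k j h'' h'
      · exact hd12 i j
      · rw [h12 k i j, hsorted k i j h'' h, neg_zero]
  · exact hd12 i k
  · rw [h12 j i k, neg_eq_zero]
    rcases lt_trichotomy i k with h' | rfl | h'
    · exact hsorted j i k h h'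
    · exact hd23 i j
    · rw [h23 j k i, neg_eq_zero]
      rcases lt_trichotomy j k with h'' | rfl | h''
      · exact hsorted j k i h'' h'
      · exact hd12 j i
      · rw [h12 k j i, hsorted k j i h'' h, neg_zero]

/-- The alternating form `e_i^* ∧ e_j^* ∧ e_k^*` attached to three coordinates. -/
noncomputable def coordForm {A : Type*} [AddCommGroup A] [Module ℂ A] (b : Basis (Fin 8) ℂ A)
    (s : Fin 3 → Fin 8) : A [⋀^Fin 3]→ₗ[ℂ] ℂ :=
  Matrix.detRowAlternating.compLinearMap (LinearMap.pi fun i => b.coord (s i))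

theorem coordForm_apply {A : Type*} [AddCommGroup A] [Module ℂ A] (b : Basis (Fin 8) ℂ A)
    (s : Fin 3 → Fin 8) (v : Fin 3 → A) :
    coordForm b s v = Matrix.det (Matrix.of fun i j => b.repr (v i) (s j)) := rfl

/-- The supports of the six terms of `cartanForm`. -/
def cartanTriples : Finset (Fin 3 → Fin 8) :=
  {![0, 2, 5], ![1, 3, 6], ![0, 4, 7], ![1, 4, 7], ![2, 3, 7], ![4, 5, 6]}

theorem sum_cartanTriples {M : Type*} [AddCommMonoid M] (f : (Fin 3 → Fin 8) → M) :
    ∑ s ∈ cartanTriples, f s = f ![0, 2, 5] + (f ![1, 3, 6] + (f ![0, 4, 7] +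
      (f ![1, 4, 7] + (f ![2, 3, 7] + f ![4, 5, 6])))) := by
  rw [cartanTriples, Finset.sum_insert (by decide), Finset.sum_insert (by decide),
    Finset.sum_insert (by decide), Finset.sum_insert (by decide), Finset.sum_insert (by decide),
    Finset.sum_singleton]

/-- In a suitable weight basis, the form `(x, y, z) ↦ K([x, y], z)` on `𝔰𝔩₃`, with the torus
rescaled so that all coefficients are `1`. Its stabilizer in `𝔤𝔩₈` is a copy of `𝔰𝔩₃`. -/
noncomputable def cartanForm {A : Type*} [AddCommGroup A] [Module ℂ A] (b : Basis (Fin 8) ℂ A) :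
    ⋀[ℂ]^3 A :=
  ∑ s ∈ cartanTriples, exteriorPower.ιMulti ℂ 3 (b ∘ s)

/-- The functional on `⋀³A` with `D³(X)(cartanForm b) ↦ 3 * trace X`. -/
noncomputable def dualCartanForm {A : Type*} [AddCommGroup A] [Module ℂ A]
    (b : Basis (Fin 8) ℂ A) : ⋀[ℂ]^3 A →ₗ[ℂ] ℂ :=
  exteriorPower.alternatingMapLinearEquiv
    ((2 : ℂ) • coordForm b ![0, 2, 5] - coordForm b ![1, 2, 5] - coordForm b ![0, 3, 6]
      + (2 : ℂ) • coordForm b ![1, 3, 6] + coordForm b ![0, 4, 7] + coordForm b ![1, 4, 7]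
      + coordForm b ![2, 3, 7] + coordForm b ![4, 5, 6])

section
variable {A : Type*} [AddCommGroup A] [Module ℂ A]
  {D : Module.End ℂ A →ₗ[ℂ] (⋀[ℂ]^3 A →ₗ[ℂ] ⋀[ℂ]^3 A)}

theorem IsDerivationAction.apply_cartanForm (hD : IsDerivationAction D)
    (b : Basis (Fin 8) ℂ A) (X : Module.End ℂ A) (φ : ⋀[ℂ]^3 A →ₗ[ℂ] ℂ) :
    φ (D X (cartanForm b)) =
      ∑ s ∈ cartanTriples,
        (φ (exteriorPower.ιMulti ℂ 3 ![X (b (s 0)), b (s 1), b (s 2)]) +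
          φ (exteriorPower.ιMulti ℂ 3 ![b (s 0), X (b (s 1)), b (s 2)]) +
          φ (exteriorPower.ιMulti ℂ 3 ![b (s 0), b (s 1), X (b (s 2))])) := by
  simp only [cartanForm, map_sum]
  refine Finset.sum_congr rfl fun s _ => ?_
  have h := hD X (b ∘ s)
  rw [h, map_sum, Fin.sum_univ_three]
  congr 3

theorem IsDerivationAction.dualCartanForm_apply (hD : IsDerivationAction D)
    (b : Basis (Fin 8) ℂ A) (X : Module.End ℂ A) :
    dualCartanForm b (D X (cartanForm b)) = 3 * LinearMap.trace ℂ A X := by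
  rw [hD.apply_cartanForm, sum_cartanTriples, LinearMap.trace_eq_matrix_trace ℂ b, Matrix.trace]
  simp only [Matrix.diag, LinearMap.toMatrix_apply, dualCartanForm,
    exteriorPower.alternatingMapLinearEquiv_apply_ιMulti, AlternatingMap.add_apply,
    AlternatingMap.sub_apply, AlternatingMap.smul_apply, coordForm_apply, Matrix.det_fin_three,
    Matrix.of_apply]
  simp [Fin.sum_univ_eight]
  ring

theorem IsDerivationAction.surjective_cartanForm (hD : IsDerivationAction D)
    (b : Basis (Fin 8) ℂ A) : Function.Surjective (D.flip (cartanForm b)) := by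
  rw [← LinearMap.range_eq_top]
  by_contra hne
  obtain ⟨φ, hφ, hker⟩ := Submodule.exists_le_ker_of_lt_top _ (lt_top_iff_ne_top.2 hne)
  let f := φ.compAlternatingMap (exteriorPower.ιMulti ℂ 3 (M := A))
  let t : Fin 8 → Fin 8 → Fin 8 → ℂ := fun i j k => f ![b i, b j, b k]
  have hX : ∀ X, φ (D X (cartanForm b)) = 0 := fun X => hker ⟨X, rfl⟩
  have hE : ∀ p q, φ (D (b.constr ℂ (Pi.single q (b p))) (cartanForm b)) = 0 := fun p q => hX _
  simp only [hD.apply_cartanForm, sum_cartanTriples] at hE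
  have h12 : ∀ i j k, t j i k = -t i j k := fun i j k => by
    have := f.map_swap ![b i, b j, b k] (i := 0) (j := 1) (by decide)
    rw [← this]
    refine congrArg f (funext fun l => ?_)
    fin_cases l <;> simp [Equiv.swap_apply_def]
  have h23 : ∀ i j k, t i k j = -t i j k := fun i j k => by
    have := f.map_swap ![b i, b j, b k] (i := 1) (j := 2) (by decide)
    rw [← this]
    refine congrArg f (funext fun l => ?_)
    fin_cases l <;> simp [Equiv.swap_apply_def]
  have ht : ∀ i j k, φ (exteriorPower.ιMulti ℂ 3 ![b i, b j, b k]) = t i j k :=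
    fun _ _ _ => rfl
  have hz : ∀ (v : Fin 3 → A) l, v l = 0 → φ (exteriorPower.ιMulti ℂ 3 v) = 0 :=
    fun v l h => f.map_coord_zero l h
  have hz0 : ∀ x y, φ (exteriorPower.ιMulti ℂ 3 ![0, x, y]) = 0 := fun x y => hz _ 0 rfl
  have hz1 : ∀ x y, φ (exteriorPower.ιMulti ℂ 3 ![x, 0, y]) = 0 := fun x y => hz _ 1 rfl
  have hz2 : ∀ x y, φ (exteriorPower.ιMulti ℂ 3 ![x, y, 0]) = 0 := fun x y => hz _ 2 rfl
  have key : ∀ i j k, t i j k = 0 := by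
    refine alternating_eq_zero h12 h23 ?_ ?_ ?_ ?_ ?_ ?_ ?_ ?_ <;> intro p
    · simpa [Pi.single_apply, hz0, hz1, hz2, ht] using hE p 0
    · simpa [Pi.single_apply, hz0, hz1, hz2, ht] using hE p 1
    · simpa [Pi.single_apply, hz0, hz1, hz2, ht] using hE p 2
    · simpa [Pi.single_apply, hz0, hz1, hz2, ht] using hE p 3
    · simpa [Pi.single_apply, hz0, hz1, hz2, ht, add_assoc] using hE p 4
    · simpa [Pi.single_apply, hz0, hz1, hz2, ht] using hE p 5
    · simpa [Pi.single_apply, hz0, hz1, hz2, ht] using hE p 6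
    · simpa [Pi.single_apply, hz0, hz1, hz2, ht, add_assoc] using hE p 7
  apply hφ
  refine exteriorPower.linearMap_ext (b.ext_alternating fun v _ => ?_)
  refine Eq.trans (congrArg f (funext fun l => ?_)) (key (v 0) (v 1) (v 2))
  fin_cases l <;> rfl

theorem IsDerivationAction.not_surjective_cartanForm (hD : IsDerivationAction D)
    (b : Basis (Fin 8) ℂ A) : ¬ Function.Surjective
      ((D.flip (cartanForm b)).domRestrict (LinearMap.ker (LinearMap.trace ℂ A))) := by
  intro h
  obtain ⟨⟨X, hX⟩, hy⟩ := h (D LinearMap.id (cartanForm b))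
  have hX' : LinearMap.trace ℂ A X = 0 := hX
  have h1 : D X (cartanForm b) = D LinearMap.id (cartanForm b) := hy
  have h2 := congrArg (dualCartanForm b) h1
  have : Module.Finite ℂ A := b.finiteDimensional_of_finite
  rw [hD.dualCartanForm_apply, hD.dualCartanForm_apply, hX', LinearMap.trace_id,
    finrank_eq_card_basis b] at h2
  norm_num at h2
end

/-- Let `A = ℂ⁸` and let `D³(X) : ⋀³A → ⋀³A` be the derivation action of an endomorphism `X`,
i.e. the linear map with `D³(X)(a∧b∧c) = (Xa)∧b∧c + a∧(Xb)∧c + a∧b∧(Xc)`. Then for every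
`ω ∈ ⋀³A`, the linear map `𝔰𝔩(A) → ⋀³A`, `X ↦ D³(X)(ω)`, on traceless endomorphisms, is not
surjective; equivalently its rank is at most `34 = dim ⋀³ℂ⁸ − 1`. -/
theorem derivation_action_not_surjective_dim_eight
    {A : Type*} [AddCommGroup A] [Module ℂ A] [FiniteDimensional ℂ A]
    (hA : finrank ℂ A = 8)
    (D : Module.End ℂ A →ₗ[ℂ] (⋀[ℂ]^3 A →ₗ[ℂ] ⋀[ℂ]^3 A))
    (hD : ∀ (X : Module.End ℂ A) (x : ⋀[ℂ]^3 A) (a b c : A),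
      (x : ExteriorAlgebra ℂ A) = ιMulti ℂ 3 ![a, b, c] →
        (D X x : ExteriorAlgebra ℂ A) =
          ιMulti ℂ 3 ![X a, b, c] + ιMulti ℂ 3 ![a, X b, c] + ιMulti ℂ 3 ![a, b, X c])
    (ω : ⋀[ℂ]^3 A) :
    ¬ Function.Surjective
        ((D.flip ω).domRestrict (LinearMap.ker (LinearMap.trace ℂ A))) ∧
      finrank ℂ (LinearMap.range
        ((D.flip ω).domRestrict (LinearMap.ker (LinearMap.trace ℂ A)))) ≤ 55 := by
  have hD' : IsDerivationAction D := fun X a => by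
    have ha : a = ![a 0, a 1, a 2] := by
      funext i
      fin_cases i <;> rfl
    refine Subtype.ext ?_
    rw [hD X _ (a 0) (a 1) (a 2) (congrArg (ExteriorAlgebra.ιMulti ℂ 3) ha), Fin.sum_univ_three]
    simp only [Submodule.coe_add, exteriorPower.ιMulti_apply_coe]
    congr 3 <;> funext i <;> fin_cases i <;> rfl
  let b := finBasisOfFinrankEq ℂ A hA
  have h := hD'.not_surjective (cartanForm b) (hD'.surjective_cartanForm b)
    (hD'.not_surjective_cartanForm b) ω
  refine ⟨h, Nat.le_of_lt_succ ?_⟩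
  have h56 : finrank ℂ (⋀[ℂ]^3 A) = 56 := by
    rw [exteriorPower.finrank_eq, hA]
    rfl
  exact (Submodule.finrank_lt (mt LinearMap.range_eq_top.1 h)).trans_eq h56
end
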